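/- arXiv:1902.10087 — 3 statements merged into one kernel-verified Lean document; each statement's English description precedes it below -/
import Mathlib

section
/- Let ρ_ABC be an invertible density operator on H_A⊗H_B⊗H_C with marginals ρ_AB = Tr_C ρ_ABC, ρ_BC = Tr_A ρ_ABC, satisfying I_{ρ_ABC}(A:C|B) = 0. Then every density operator σ on H_A⊗H_B⊗H_C with Tr_C σ = ρ_AB and Tr_A σ = ρ_BC satisfies S(σ) ≤ S(ρ_ABC); that is, the quantum Markov chain is the maximum von Neumann entropy state compatible with the two bipartite marginals. -/
open scoped Matrix ComplexOrder

variable {A B C : Type*}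

/-- Functional calculus for Hermitian matrices: apply `f : ℝ → ℝ` to the eigenvalues. -/
noncomputable def matFun {n : Type*} [Fintype n] [DecidableEq n]
    (f : ℝ → ℝ) (ρ : Matrix n n ℂ) : Matrix n n ℂ :=
  if h : ρ.IsHermitian then
    (h.eigenvectorUnitary : Matrix n n ℂ) *
      Matrix.diagonal (fun i => (f (h.eigenvalues i) : ℂ)) *
        (star (h.eigenvectorUnitary : Matrix n n ℂ))
  else 0

/-- Matrix logarithm via functional calculus. -/
noncomputable def matLog {n : Type*} [Fintype n] [DecidableEq n] (ρ : Matrix n n ℂ) :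
    Matrix n n ℂ := matFun Real.log ρ

/-- Matrix square root via functional calculus. -/
noncomputable def matSqrt {n : Type*} [Fintype n] [DecidableEq n] (ρ : Matrix n n ℂ) :
    Matrix n n ℂ := matFun Real.sqrt ρ

/-- Matrix inverse square root via functional calculus. -/
noncomputable def matInvSqrt {n : Type*} [Fintype n] [DecidableEq n] (ρ : Matrix n n ℂ) :
    Matrix n n ℂ := matFun (fun x => (Real.sqrt x)⁻¹) ρ

/-- A density operator: positive semidefinite with trace one. -/
def IsDensity {n : Type*} [Fintype n] (ρ : Matrix n n ℂ) : Prop :=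
  ρ.PosSemidef ∧ ρ.trace = 1

/-- The von Neumann entropy `S(ρ) = -Tr(ρ log ρ)`, computed via eigenvalues. -/
noncomputable def vnEntropy {n : Type*} [Fintype n] [DecidableEq n] (ρ : Matrix n n ℂ) : ℝ :=
  if h : ρ.IsHermitian then -∑ i, h.eigenvalues i * Real.log (h.eigenvalues i) else 0

/-- The quantum relative entropy `S(ρ‖σ) = Tr[ρ (log ρ - log σ)]`. -/
noncomputable def relEntropy {n : Type*} [Fintype n] [DecidableEq n]
    (ρ σ : Matrix n n ℂ) : ℝ := ((ρ * (matLog ρ - matLog σ)).trace).re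

section Tripartite

variable [Fintype A] [Fintype B] [Fintype C]

/-- Partial trace over the third factor. -/
noncomputable def ptC (ρ : Matrix (A × B × C) (A × B × C) ℂ) : Matrix (A × B) (A × B) ℂ :=
  fun x y => ∑ c : C, ρ (x.1, x.2, c) (y.1, y.2, c)

/-- Partial trace over the first factor. -/
noncomputable def ptA (ρ : Matrix (A × B × C) (A × B × C) ℂ) : Matrix (B × C) (B × C) ℂ :=
  fun x y => ∑ a : A, ρ (a, x) (a, y)

/-- Partial trace over the first and third factors. -/
noncomputable def ptAC (ρ : Matrix (A × B × C) (A × B × C) ℂ) : Matrix B B ℂ :=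
  fun b b' => ∑ a : A, ∑ c : C, ρ (a, b, c) (a, b', c)

/-- Partial trace over the first and second factors. -/
noncomputable def ptAB (ρ : Matrix (A × B × C) (A × B × C) ℂ) : Matrix C C ℂ :=
  fun c c' => ∑ a : A, ∑ b : B, ρ (a, b, c) (a, b, c')

/-- Partial trace over the second and third factors. -/
noncomputable def ptBC (ρ : Matrix (A × B × C) (A × B × C) ℂ) : Matrix A A ℂ :=
  fun a a' => ∑ b : B, ∑ c : C, ρ (a, b, c) (a', b, c)

/-- Partial trace of a bipartite state over its first factor. -/
noncomputable def bptFst {X Y : Type*} [Fintype X] [Fintype Y]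
    (M : Matrix (X × Y) (X × Y) ℂ) : Matrix Y Y ℂ :=
  fun b b' => ∑ x : X, M (x, b) (x, b')

/-- Partial trace of a bipartite state over its second factor. -/
noncomputable def bptSnd {X Y : Type*} [Fintype X] [Fintype Y]
    (M : Matrix (X × Y) (X × Y) ℂ) : Matrix X X ℂ :=
  fun a a' => ∑ y : Y, M (a, y) (a', y)

variable [DecidableEq A] [DecidableEq B] [DecidableEq C]

/-- Extend an operator on the first two factors to the tripartite space: `M ⊗ id_C`. -/
noncomputable def extAB (M : Matrix (A × B) (A × B) ℂ) :
    Matrix (A × B × C) (A × B × C) ℂ :=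
  fun x y => M (x.1, x.2.1) (y.1, y.2.1) * (if x.2.2 = y.2.2 then 1 else 0)

/-- Extend an operator on the last two factors to the tripartite space: `id_A ⊗ M`. -/
noncomputable def extBC (M : Matrix (B × C) (B × C) ℂ) :
    Matrix (A × B × C) (A × B × C) ℂ :=
  fun x y => (if x.1 = y.1 then 1 else 0) * M x.2 y.2

/-- Extend an operator on the middle factor to the tripartite space: `id_A ⊗ M ⊗ id_C`. -/
noncomputable def extB (M : Matrix B B ℂ) : Matrix (A × B × C) (A × B × C) ℂ :=
  fun x y => (if x.1 = y.1 then 1 else 0) * M x.2.1 y.2.1 * (if x.2.2 = y.2.2 then 1 else 0)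

/-- Quantum conditional mutual information `I_ρ(A:C|B)`. -/
noncomputable def qcmi (ρ : Matrix (A × B × C) (A × B × C) ℂ) : ℝ :=
  vnEntropy (ptC ρ) + vnEntropy (ptA ρ) - vnEntropy (ptAC ρ) - vnEntropy ρ

end Tripartite

namespace SSA

open Matrix Filter Topology
open scoped Kronecker

noncomputable def Q {n : Type*} [Fintype n] (ρ σ : Matrix n n ℂ) (t : ℝ) (X : Matrix n n ℂ) : ℝ :=
  2 * ((ρ * X).trace).re - ((σ * (X * Xᴴ)).trace).re - t * ((ρ * (Xᴴ * X)).trace).re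

noncomputable def W2 {n : Type*} [Fintype n] (U V : Matrix n n ℂ) (i j : n) : ℝ :=
  Complex.normSq ((Vᴴ * U) i j)

lemma conj_tr {n : Type*} [Fintype n] [DecidableEq n] (U V Y : Matrix n n ℂ)
    (hU : Uᴴ * U = 1) (hV : Vᴴ * V = 1) (l m : n → ℝ) (t : ℝ) :
    Q (U * diagonal (fun i => (l i : ℂ)) * Uᴴ) (V * diagonal (fun i => (m i : ℂ)) * Vᴴ) t
      (V * Y * Uᴴ) = ∑ i, ∑ j, (2 * l j * (star ((Vᴴ * U) i j) * Y i j).re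
        - (m i + t * l j) * Complex.normSq (Y i j)) := by
  have e1 : (U * diagonal (fun i => (l i : ℂ)) * Uᴴ * (V * Y * Uᴴ)).trace
      = ∑ i, ∑ j, (l j : ℂ) * (star ((Vᴴ * U) i j) * Y i j) := by
    have : (U * diagonal (fun i => (l i : ℂ)) * Uᴴ * (V * Y * Uᴴ)).trace
        = (diagonal (fun i => (l i : ℂ)) * ((Vᴴ * U)ᴴ * Y)).trace := by
      rw [trace_mul_comm]
      simp only [conjTranspose_mul, conjTranspose_conjTranspose, Matrix.mul_assoc]
      rw [← Matrix.mul_assoc Uᴴ U, hU, Matrix.one_mul, ← Matrix.mul_assoc V,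
        trace_mul_comm]
      simp only [Matrix.mul_assoc]
    rw [this, Finset.sum_comm]
    simp only [trace, diag_apply, diagonal_mul, mul_apply (M := (Vᴴ * U)ᴴ), conjTranspose_apply,
      Finset.mul_sum]
  have e2 : (V * diagonal (fun i => (m i : ℂ)) * Vᴴ * ((V * Y * Uᴴ) * (V * Y * Uᴴ)ᴴ)).trace
      = ∑ i, ∑ j, (m i : ℂ) * (Complex.normSq (Y i j) : ℂ) := by
    have : (V * diagonal (fun i => (m i : ℂ)) * Vᴴ * ((V * Y * Uᴴ) * (V * Y * Uᴴ)ᴴ)).trace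
        = (diagonal (fun i => (m i : ℂ)) * (Y * Yᴴ)).trace := by
      simp only [conjTranspose_mul, conjTranspose_conjTranspose, Matrix.mul_assoc]
      rw [← Matrix.mul_assoc Uᴴ U, hU, Matrix.one_mul, ← Matrix.mul_assoc Vᴴ V, hV,
        Matrix.one_mul, trace_mul_comm]
      simp only [Matrix.mul_assoc]
      rw [hV, Matrix.mul_one]
    rw [this]
    simp only [trace, diag_apply, diagonal_mul, mul_apply (M := Y), conjTranspose_apply,
      Finset.mul_sum, Complex.normSq_eq_conj_mul_self, mul_comm (star _)]
    simp [mul_comm]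
  have e3 : (U * diagonal (fun i => (l i : ℂ)) * Uᴴ * ((V * Y * Uᴴ)ᴴ * (V * Y * Uᴴ))).trace
      = ∑ i, ∑ j, (l j : ℂ) * (Complex.normSq (Y i j) : ℂ) := by
    have : (U * diagonal (fun i => (l i : ℂ)) * Uᴴ * ((V * Y * Uᴴ)ᴴ * (V * Y * Uᴴ))).trace
        = (diagonal (fun i => (l i : ℂ)) * (Yᴴ * Y)).trace := by
      simp only [conjTranspose_mul, conjTranspose_conjTranspose, Matrix.mul_assoc]
      rw [← Matrix.mul_assoc Uᴴ U, hU, Matrix.one_mul, ← Matrix.mul_assoc Vᴴ V, hV,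
        Matrix.one_mul, trace_mul_comm]
      simp only [Matrix.mul_assoc]
      rw [hU, Matrix.mul_one]
    rw [this, Finset.sum_comm]
    simp only [trace, diag_apply, diagonal_mul, mul_apply (M := Yᴴ), conjTranspose_apply,
      Finset.mul_sum, Complex.normSq_eq_conj_mul_self]
    simp
  unfold Q
  rw [e1, e2, e3]
  simp only [Complex.re_sum, ← Complex.ofReal_mul, Complex.ofReal_re, Complex.re_ofReal_mul,
    Finset.mul_sum, ← Finset.sum_sub_distrib]
  refine Finset.sum_congr rfl fun i _ => Finset.sum_congr rfl fun j _ => ?_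
  ring

noncomputable def phi {n : Type*} [Fintype n] (U V : Matrix n n ℂ) (l m : n → ℝ) (t : ℝ) : ℝ :=
  ∑ i, ∑ j, W2 U V i j * (l j * (l j / (m i + t * l j)))

lemma scalar_le (l d : ℝ) (hd : 0 < d) (w y : ℂ) :
    2 * l * (star w * y).re - d * Complex.normSq y ≤ Complex.normSq w * (l * (l / d)) := by
  have : Complex.normSq w * (l * (l / d)) - (2 * l * (star w * y).re - d * Complex.normSq y)
      = ((d * y.re - l * w.re)^2 + (d * y.im - l * w.im)^2) / d := by
    simp [Complex.normSq_apply]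
    field_simp
    ring
  have h2 : 0 ≤ ((d * y.re - l * w.re)^2 + (d * y.im - l * w.im)^2) / d := by positivity
  linarith

lemma scalar_eq (l d : ℝ) (hd : 0 < d) (w : ℂ) :
    2 * l * (star w * (((l / d : ℝ) : ℂ) * w)).re - d * Complex.normSq (((l / d : ℝ) : ℂ) * w)
      = Complex.normSq w * (l * (l / d)) := by
  simp only [Complex.normSq_mul, Complex.normSq_ofReal]
  simp [Complex.normSq_apply, -Complex.ofReal_div]
  field_simp
  ring

lemma Q_le {n : Type*} [Fintype n] [DecidableEq n] (U V X : Matrix n n ℂ)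
    (hU : Uᴴ * U = 1) (hV : Vᴴ * V = 1) (l m : n → ℝ) (t : ℝ) (hl : ∀ i, 0 ≤ l i)
    (hm : ∀ i, 0 < m i) (ht : 0 ≤ t) :
    Q (U * diagonal (fun i => (l i : ℂ)) * Uᴴ) (V * diagonal (fun i => (m i : ℂ)) * Vᴴ) t X
      ≤ phi U V l m t := by
  have hX : X = V * (Vᴴ * X * U) * Uᴴ := by
    have hU' : U * Uᴴ = 1 := mul_eq_one_comm.mp hU
    have hV' : V * Vᴴ = 1 := mul_eq_one_comm.mp hV
    simp only [Matrix.mul_assoc]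
    rw [hU', ← Matrix.mul_assoc V, hV']; simp
  rw [hX, conj_tr U V _ hU hV]
  refine Finset.sum_le_sum fun i _ => Finset.sum_le_sum fun j _ => ?_
  exact scalar_le _ _ (by have := hl j; have := hm i; positivity) _ _

lemma Q_eq {n : Type*} [Fintype n] [DecidableEq n] (U V : Matrix n n ℂ)
    (hU : Uᴴ * U = 1) (hV : Vᴴ * V = 1) (l m : n → ℝ) (t : ℝ) (hl : ∀ i, 0 ≤ l i)
    (hm : ∀ i, 0 < m i) (ht : 0 ≤ t) : ∃ X,
    Q (U * diagonal (fun i => (l i : ℂ)) * Uᴴ) (V * diagonal (fun i => (m i : ℂ)) * Vᴴ) t X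
      = phi U V l m t := by
  refine ⟨V * (Matrix.of fun i j => ((l j / (m i + t * l j) : ℝ) : ℂ) * (Vᴴ * U) i j) * Uᴴ, ?_⟩
  rw [conj_tr U V _ hU hV]
  refine Finset.sum_congr rfl fun i _ => Finset.sum_congr rfl fun j _ => ?_
  exact scalar_eq _ _ (by have := hl j; have := hm i; positivity) _

noncomputable def G {n : Type*} [Fintype n] (U V : Matrix n n ℂ) (l m : n → ℝ) (t : ℝ) : ℝ :=
  ∑ i, ∑ j, W2 U V i j * (l j * (Real.log (m i + t * l j) - Real.log (m i)))

lemma G_deriv {n : Type*} [Fintype n] (U V : Matrix n n ℂ) (l m : n → ℝ)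
    (hl : ∀ i, 0 ≤ l i) (hm : ∀ i, 0 < m i) (t : ℝ) (ht : 0 ≤ t) :
    HasDerivAt (G U V l m) (phi U V l m t) t := by
  unfold G phi
  refine HasDerivAt.fun_sum fun i _ => HasDerivAt.fun_sum fun j _ => ?_
  refine HasDerivAt.const_mul _ (HasDerivAt.const_mul _ ?_)
  have h1 : HasDerivAt (fun t : ℝ => m i + t * l j) (l j) t := by
    simpa using ((hasDerivAt_id t).mul_const (l j)).const_add (m i)
  have := hl j
  have := hm i
  exact (h1.log (by positivity)).sub_const _

lemma W2_sum {n : Type*} [Fintype n] [DecidableEq n] (U V : Matrix n n ℂ)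
    (hU : Uᴴ * U = 1) (hV : Vᴴ * V = 1) (j : n) : ∑ i, W2 U V i j = 1 := by
  have hV' : V * Vᴴ = 1 := mul_eq_one_comm.mp hV
  have h : (Vᴴ * U)ᴴ * (Vᴴ * U) = 1 := by
    simp only [conjTranspose_mul, conjTranspose_conjTranspose, Matrix.mul_assoc]
    rw [← Matrix.mul_assoc V, hV', Matrix.one_mul, hU]
  have h2 := congrFun (congrFun h j) j
  rw [mul_apply, one_apply_eq] at h2
  have h3 : ((∑ i, W2 U V i j : ℝ) : ℂ) = 1 := by
    rw [← h2]
    push_cast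
    refine Finset.sum_congr rfl fun i _ => ?_
    rw [W2, Complex.normSq_eq_conj_mul_self, conjTranspose_apply]; rfl
  exact_mod_cast h3

lemma tr_log {n : Type*} [Fintype n] [DecidableEq n] (U V : Matrix n n ℂ) (l f : n → ℝ) :
    ((U * diagonal (fun i => (l i : ℂ)) * Uᴴ * (V * diagonal (fun i => (f i : ℂ)) * Vᴴ)).trace).re
      = ∑ i, ∑ j, W2 U V i j * (l j * f i) := by
  have : (U * diagonal (fun i => (l i : ℂ)) * Uᴴ * (V * diagonal (fun i => (f i : ℂ)) * Vᴴ)).trace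
      = ((diagonal (fun i => (f i : ℂ))) * ((Vᴴ * U) *
          (diagonal (fun i => (l i : ℂ)) * (Vᴴ * U)ᴴ))).trace := by
    rw [trace_mul_comm, ← Matrix.mul_assoc, Matrix.mul_assoc V, Matrix.mul_assoc V, Matrix.mul_assoc V,
      trace_mul_comm]
    simp only [conjTranspose_mul, conjTranspose_conjTranspose, Matrix.mul_assoc]
  rw [this]
  simp only [trace, diag_apply, diagonal_mul, mul_apply (M := Vᴴ * U), conjTranspose_apply,
      Finset.mul_sum, Complex.re_sum]
  refine Finset.sum_congr rfl fun i _ => Finset.sum_congr rfl fun j _ => ?_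
  simp [W2, Complex.normSq_apply]
  ring

lemma G_lim {n : Type*} [Fintype n] [DecidableEq n] (U V : Matrix n n ℂ) (l m : n → ℝ)
    (hU : Uᴴ * U = 1) (hV : Vᴴ * V = 1)
    (hl : ∀ i, 0 ≤ l i) (hm : ∀ i, 0 < m i) :
    Tendsto (fun t => G U V l m t - (∑ j, l j) * Real.log t) atTop
      (𝓝 (∑ j, l j * Real.log (l j) -
        ((U * diagonal (fun i => (l i : ℂ)) * Uᴴ *
          (V * diagonal (fun i => (Real.log (m i) : ℂ)) * Vᴴ)).trace).re)) := by
  rw [tr_log U V l (fun i => Real.log (m i))]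
  have e1 : ∀ f : n → ℝ, ∑ j, f j = ∑ i, ∑ j, W2 U V i j * f j := by
    intro f
    rw [Finset.sum_comm]
    simp only [← Finset.sum_mul, W2_sum U V hU hV, one_mul]
  rw [e1 (fun j => l j * Real.log (l j)), ← Finset.sum_sub_distrib]
  simp only [← Finset.sum_sub_distrib]
  have key : Tendsto (fun t : ℝ => ∑ i, ∑ j, (W2 U V i j * (l j * Real.log (l j + m i * t⁻¹)) -
      W2 U V i j * (l j * Real.log (m i)))) atTop (𝓝 (∑ i, ∑ j, (W2 U V i j *
        (l j * Real.log (l j)) - W2 U V i j * (l j * Real.log (m i))))) := by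
    refine tendsto_finsetSum _ fun i _ => tendsto_finsetSum _ fun j _ => ?_
    refine Tendsto.sub_const (Tendsto.const_mul _ ?_) _
    rcases (hl j).eq_or_lt with h | h
    · simp [← h]
    · refine Tendsto.const_mul _ ?_
      refine Tendsto.log ?_ h.ne'
      simpa using (tendsto_inv_atTop_zero.const_mul (m i)).const_add (l j)
  refine key.congr' ?_
  filter_upwards [eventually_gt_atTop 0] with t ht
  rw [e1 l, G, Finset.sum_mul, ← Finset.sum_sub_distrib]
  refine Finset.sum_congr rfl fun i _ => ?_
  rw [Finset.sum_mul, ← Finset.sum_sub_distrib]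
  refine Finset.sum_congr rfl fun j _ => ?_
  have h1 := hl j
  have h2 := hm i
  have : m i + t * l j = t * (l j + m i * t⁻¹) := by field_simp; ring
  rw [this, Real.log_mul ht.ne' (by positivity)]
  ring

lemma tr_extBC {A n : Type*} [Fintype A] [Fintype n] [DecidableEq A]
    (ρ : Matrix (A × n) (A × n) ℂ) (X : Matrix n n ℂ) :
    (ρ * ((1 : Matrix A A ℂ) ⊗ₖ X)).trace = (bptFst ρ * X).trace := by
  simp only [trace, diag_apply, mul_apply, Fintype.sum_prod_type, kroneckerMap_apply, one_apply,
    bptFst, Finset.sum_mul]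
  rw [Finset.sum_comm]
  refine Finset.sum_congr rfl fun j _ => ?_
  rw [Finset.sum_comm (γ := n)]
  simp only [ite_mul, one_mul, zero_mul, mul_ite, mul_zero]
  simp
  try rw [Finset.sum_comm]

lemma mono {A n : Type*} [Fintype A] [Fintype n] [DecidableEq A] [DecidableEq n]
    (ρ σ : Matrix (A × n) (A × n) ℂ)
    (U V : Matrix (A × n) (A × n) ℂ) (l m : A × n → ℝ) (hU : Uᴴ * U = 1) (hV : Vᴴ * V = 1)
    (hl : ∀ i, 0 ≤ l i) (hm : ∀ i, 0 < m i)
    (U' V' : Matrix n n ℂ) (l' m' : n → ℝ) (hU' : U'ᴴ * U' = 1) (hV' : V'ᴴ * V' = 1)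
    (hl' : ∀ i, 0 ≤ l' i) (hm' : ∀ i, 0 < m' i)
    (hρ : ρ = U * diagonal (fun i => (l i : ℂ)) * Uᴴ)
    (hσ : σ = V * diagonal (fun i => (m i : ℂ)) * Vᴴ)
    (hρ' : bptFst ρ = U' * diagonal (fun i => (l' i : ℂ)) * U'ᴴ)
    (hσ' : bptFst σ = V' * diagonal (fun i => (m' i : ℂ)) * V'ᴴ) :
    ∑ j, l' j * Real.log (l' j) -
        ((bptFst ρ * (V' * diagonal (fun i => (Real.log (m' i) : ℂ)) * V'ᴴ)).trace).re ≤
    ∑ j, l j * Real.log (l j) -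
        ((ρ * (V * diagonal (fun i => (Real.log (m i) : ℂ)) * Vᴴ)).trace).re := by
  have hphi : ∀ t, 0 ≤ t → phi U' V' l' m' t ≤ phi U V l m t := by
    intro t ht
    obtain ⟨X, hX⟩ := Q_eq U' V' hU' hV' l' m' t hl' hm' ht
    rw [← hX, ← hρ', ← hσ']
    refine le_trans (le_of_eq ?_) (Q_le U V ((1 : Matrix A A ℂ) ⊗ₖ X) hU hV l m t hl hm ht)
    rw [← hρ, ← hσ]
    unfold Q
    have e : ((1 : Matrix A A ℂ) ⊗ₖ X)ᴴ = (1 : Matrix A A ℂ) ⊗ₖ Xᴴ := by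
      rw [conjTranspose_kronecker]; simp
    rw [e, ← mul_kronecker_mul, ← mul_kronecker_mul, Matrix.one_mul, tr_extBC, tr_extBC, tr_extBC]
  have hG : ∀ t, 0 ≤ t → G U' V' l' m' t ≤ G U V l m t := by
    have hd : ∀ t, 0 ≤ t → HasDerivAt (fun t => G U V l m t - G U' V' l' m' t)
        (phi U V l m t - phi U' V' l' m' t) t := fun t ht =>
      (G_deriv U V l m hl hm t ht).fun_sub (G_deriv U' V' l' m' hl' hm' t ht)
    have hmono : MonotoneOn (fun t => G U V l m t - G U' V' l' m' t) (Set.Ici 0) := by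
      refine monotoneOn_of_deriv_nonneg (convex_Ici 0)
        (fun t ht => (hd t ht).continuousAt.continuousWithinAt)
        (fun t ht => (hd t (interior_subset ht)).differentiableAt.differentiableWithinAt) ?_
      intro t ht
      have ht := interior_subset ht
      rw [(hd t ht).deriv]
      exact sub_nonneg.mpr (hphi t ht)
    intro t ht
    have := hmono (Set.self_mem_Ici) ht ht
    simp only [G, zero_mul, add_zero, sub_self, mul_zero, Finset.sum_const_zero] at this
    simp only [G]
    linarith
  have htr : ∑ j, l j = ∑ j, l' j := by
    have h1 : ∀ {k : Type _} [Fintype k] [DecidableEq k] (U : Matrix k k ℂ) (l : k → ℝ),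
        Uᴴ * U = 1 → (U * diagonal (fun i => (l i : ℂ)) * Uᴴ).trace = ((∑ j, l j : ℝ) : ℂ) := by
      intro k _ _ U l hU
      rw [trace_mul_comm, ← Matrix.mul_assoc, hU, Matrix.one_mul, trace_diagonal]
      push_cast; rfl
    have h3 : (U' * diagonal (fun i => (l' i : ℂ)) * U'ᴴ).trace = ((∑ j, l' j : ℝ) : ℂ) := by
      rw [trace_mul_comm, ← Matrix.mul_assoc, hU', Matrix.one_mul, trace_diagonal]
      push_cast; rfl
    have h2 := tr_extBC ρ 1
    rw [one_kronecker_one, Matrix.mul_one, Matrix.mul_one, hρ', hρ, h1 U l hU, h3] at h2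
    exact_mod_cast h2
  have L := G_lim U V l m hU hV hl hm
  have L' := G_lim U' V' l' m' hU' hV' hl' hm'
  rw [← hρ] at L
  rw [← hρ'] at L'
  refine le_of_tendsto_of_tendsto L' L ?_
  filter_upwards [eventually_ge_atTop 0] with t ht
  rw [htr]
  have := hG t ht
  linarith

lemma eig {n : Type*} [Fintype n] [DecidableEq n] (M : Matrix n n ℂ) (hM : M.PosSemidef) :
    ∃ (U : Matrix n n ℂ) (l : n → ℝ), Uᴴ * U = 1 ∧ (∀ i, 0 ≤ l i) ∧
      M = U * diagonal (fun i => (l i : ℂ)) * Uᴴ ∧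
      vnEntropy M = - ∑ i, l i * Real.log (l i) := by
  refine ⟨hM.isHermitian.eigenvectorUnitary, hM.isHermitian.eigenvalues, ?_,
    hM.eigenvalues_nonneg, ?_, ?_⟩
  · rw [← star_eq_conjTranspose]
    exact Unitary.coe_star_mul_self _
  · have := hM.isHermitian.spectral_theorem
    rw [Unitary.conjStarAlgAut_apply] at this
    exact this
  · rw [vnEntropy, dif_pos hM.isHermitian]

lemma bptFst_pos {X Y : Type*} [Fintype X] [Fintype Y]
    (M : Matrix (X × Y) (X × Y) ℂ) (hM : M.PosSemidef) : (bptFst M).PosSemidef := by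
  have : bptFst M = ∑ x : X, M.submatrix (fun y => (x, y)) (fun y => (x, y)) := by
    ext i j
    simp [bptFst, Matrix.sum_apply]
  rw [this]
  exact Matrix.posSemidef_sum _ fun x _ => hM.submatrix _

lemma ptC_pos {A B C : Type*} [Fintype A] [Fintype B] [Fintype C]
    (M : Matrix (A × B × C) (A × B × C) ℂ) (hM : M.PosSemidef) : (ptC M).PosSemidef := by
  have : ptC M = ∑ c : C, M.submatrix (fun y => (y.1, y.2, c)) (fun y => (y.1, y.2, c)) := by
    ext i j
    simp [ptC, Matrix.sum_apply]
  rw [this]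
  exact Matrix.posSemidef_sum _ fun x _ => hM.submatrix _

section ext
variable {A B C : Type*} [Fintype A] [Fintype B] [Fintype C]
    [DecidableEq A] [DecidableEq B] [DecidableEq C]

lemma extAB_eq (M : Matrix (A × B) (A × B) ℂ) : (extAB M : Matrix (A × B × C) (A × B × C) ℂ) =
    (M ⊗ₖ (1 : Matrix C C ℂ)).submatrix (Equiv.prodAssoc A B C).symm
      (Equiv.prodAssoc A B C).symm := by
  ext i j
  simp [extAB, one_apply]

lemma extAB_mul (M N : Matrix (A × B) (A × B) ℂ) :
    (extAB (M * N) : Matrix (A × B × C) (A × B × C) ℂ) = extAB M * extAB N := by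
  rw [extAB_eq, extAB_eq, extAB_eq, submatrix_mul_equiv, ← mul_kronecker_mul, Matrix.one_mul]

lemma extAB_star (M : Matrix (A × B) (A × B) ℂ) :
    (extAB Mᴴ : Matrix (A × B × C) (A × B × C) ℂ) = (extAB M)ᴴ := by
  rw [extAB_eq, extAB_eq, conjTranspose_submatrix, conjTranspose_kronecker, conjTranspose_one]

lemma extAB_diag (f : A × B → ℂ) :
    (extAB (diagonal f) : Matrix (A × B × C) (A × B × C) ℂ) =
      diagonal (fun x => f (x.1, x.2.1)) := by
  ext ⟨a, b, c⟩ ⟨a', b', c'⟩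
  simp only [extAB, diagonal_apply, Prod.mk.injEq]
  split_ifs <;> simp_all

lemma extAB_one : (extAB 1 : Matrix (A × B × C) (A × B × C) ℂ) = 1 := by
  rw [← diagonal_one, extAB_diag, diagonal_one]

lemma tr_extAB (ρ : Matrix (A × B × C) (A × B × C) ℂ) (X : Matrix (A × B) (A × B) ℂ) :
    (ρ * extAB X).trace = (ptC ρ * X).trace := by
  simp only [trace, diag_apply, mul_apply, Fintype.sum_prod_type, extAB, ptC, Finset.sum_mul]
  refine Finset.sum_congr rfl fun a _ => Finset.sum_congr rfl fun b _ => ?_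
  rw [Finset.sum_comm]
  refine Finset.sum_congr rfl fun a' _ => ?_
  rw [Finset.sum_comm]
  refine Finset.sum_congr rfl fun b' _ => ?_
  simp

lemma tr_extB (ρ : Matrix (B × C) (B × C) ℂ) (X : Matrix B B ℂ) :
    (ρ * (X ⊗ₖ (1 : Matrix C C ℂ))).trace = (bptSnd ρ * X).trace := by
  simp only [trace, diag_apply, mul_apply, Fintype.sum_prod_type, kroneckerMap_apply, one_apply,
    bptSnd, Finset.sum_mul]
  refine Finset.sum_congr rfl fun b _ => ?_
  rw [Finset.sum_comm]
  refine Finset.sum_congr rfl fun b' _ => ?_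
  simp

lemma bptFst_extAB (M : Matrix (A × B) (A × B) ℂ) :
    bptFst (extAB M : Matrix (A × B × C) (A × B × C) ℂ) = bptFst M ⊗ₖ (1 : Matrix C C ℂ) := by
  ext ⟨b, c⟩ ⟨b', c'⟩
  simp [bptFst, extAB, one_apply]

lemma bptSnd_ptA (ρ : Matrix (A × B × C) (A × B × C) ℂ) : bptSnd (bptFst ρ) = ptAC ρ := by
  ext b b'
  simp only [bptSnd, bptFst, ptAC]
  rw [Finset.sum_comm]

lemma bptFst_ptC (ρ : Matrix (A × B × C) (A × B × C) ℂ) : bptFst (ptC ρ) = ptAC ρ := by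
  ext b b'
  simp only [ptC, bptFst, ptAC]

lemma shift {n : Type*} [Fintype n] [DecidableEq n] (M U : Matrix n n ℂ) (l : n → ℝ)
    (hU : Uᴴ * U = 1) (hM : M = U * diagonal (fun i => (l i : ℂ)) * Uᴴ) (d : ℝ) :
    M + (d : ℂ) • (1 : Matrix n n ℂ) = U * diagonal (fun i => ((l i + d : ℝ) : ℂ)) * Uᴴ := by
  have hU' : U * Uᴴ = 1 := mul_eq_one_comm.mp hU
  have : (diagonal (fun i => ((l i + d : ℝ) : ℂ)) : Matrix n n ℂ) =
      diagonal (fun i => (l i : ℂ)) + (d : ℂ) • 1 := by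
    ext i j
    by_cases h : i = j
    · subst h; simp
    · simp [h]
  rw [this, Matrix.mul_add, Matrix.add_mul, ← hM]
  simp [hU']

lemma tr_self {n : Type*} [Fintype n] [DecidableEq n] (U : Matrix n n ℂ) (l f : n → ℝ)
    (hU : Uᴴ * U = 1) :
    ((U * diagonal (fun i => (l i : ℂ)) * Uᴴ *
      (U * diagonal (fun i => (f i : ℂ)) * Uᴴ)).trace).re = ∑ i, l i * f i := by
  rw [tr_log]
  simp only [W2, hU, one_apply, apply_ite Complex.normSq, Complex.normSq_one, Complex.normSq_zero,
    ite_mul, one_mul, zero_mul]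
  simp

lemma limB {k : Type*} [Fintype k] (m : k → ℝ) (c : ℝ) :
    Tendsto (fun d : ℝ => ∑ i, m i * Real.log (m i + c * d)) (𝓝[>] 0)
      (𝓝 (∑ i, m i * Real.log (m i))) := by
  refine tendsto_finsetSum _ fun i _ => ?_
  by_cases h : m i = 0
  · simp [h]
  · refine Tendsto.const_mul _ (Tendsto.log ?_ h)
    have : Tendsto (fun d : ℝ => m i + c * d) (𝓝 0) (𝓝 (m i + c * 0)) :=
      Continuous.tendsto (by fun_prop) 0
    rw [mul_zero, add_zero] at this
    exact this.mono_left nhdsWithin_le_nhds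

theorem ssa (σ : Matrix (A × B × C) (A × B × C) ℂ) (hσ : σ.PosSemidef) [Nonempty A] :
    vnEntropy σ + vnEntropy (ptAC σ) ≤ vnEntropy (ptC σ) + vnEntropy (ptA σ) := by
  obtain ⟨U, l, hU, hl, hd, hS⟩ := eig σ hσ
  obtain ⟨V, m, hV, hm, hdAB, hSAB⟩ := eig (ptC σ) (ptC_pos σ hσ)
  obtain ⟨U', l', hU', hl', hd', hS'⟩ := eig (bptFst σ) (bptFst_pos σ hσ)
  obtain ⟨V', m', hV', hm', hdB, hSB⟩ := eig (ptAC σ)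
    (by rw [← bptFst_ptC]; exact bptFst_pos _ (ptC_pos σ hσ))
  have hA : vnEntropy (ptA σ) = vnEntropy (bptFst σ) := rfl
  rw [hA, hS, hSAB, hS', hSB]
  have key : ∀ d : ℝ, 0 < d → ∑ j, l' j * Real.log (l' j) -
      ∑ i, m' i * Real.log (m' i + Fintype.card A * d) ≤
      ∑ j, l j * Real.log (l j) - ∑ i, m i * Real.log (m i + d) := by
    intro d hdpos
    have hc : (0 : ℝ) < Fintype.card A := by exact_mod_cast Fintype.card_pos
    have hk : ∀ f : B → ℂ, (V' ⊗ₖ (1 : Matrix C C ℂ)) * diagonal (fun x : B × C => f x.1) *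
        (V' ⊗ₖ (1 : Matrix C C ℂ))ᴴ = (V' * diagonal f * V'ᴴ) ⊗ₖ (1 : Matrix C C ℂ) := by
      intro f
      have : (diagonal (fun x : B × C => f x.1) : Matrix (B × C) (B × C) ℂ) =
          diagonal f ⊗ₖ (1 : Matrix C C ℂ) := by
        rw [← diagonal_one, diagonal_kronecker_diagonal]
        simp
      rw [this, conjTranspose_kronecker, conjTranspose_one, ← mul_kronecker_mul,
        ← mul_kronecker_mul]
      simp
    have hk2 : ∀ f : A × B → ℂ, (extAB V : Matrix (A × B × C) (A × B × C) ℂ) *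
        diagonal (fun x => f (x.1, x.2.1)) * (extAB V)ᴴ = extAB (V * diagonal f * Vᴴ) := by
      intro f
      rw [extAB_mul, extAB_mul, extAB_diag, extAB_star]
    have h := mono σ (extAB (ptC σ + (d : ℂ) • 1)) U (extAB V) l (fun x => m (x.1, x.2.1) + d)
      hU (by rw [← extAB_star, ← extAB_mul, hV, extAB_one]) hl
      (fun x => by have := hm (x.1, x.2.1); positivity)
      U' (V' ⊗ₖ (1 : Matrix C C ℂ)) l' (fun x => m' x.1 + Fintype.card A * d) hU'
      (by rw [conjTranspose_kronecker, ← mul_kronecker_mul, hV']; simp)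
      hl' (fun x => by have := hm' x.1; positivity) hd
      (by rw [hk2 (fun x => ((m x + d : ℝ) : ℂ)), ← shift _ V m hV hdAB d]) hd'
      (by
        rw [hk (fun x => ((m' x + Fintype.card A * d : ℝ) : ℂ)),
          ← shift _ V' m' hV' hdB (Fintype.card A * d), bptFst_extAB, ← bptFst_ptC]
        congr 1
        ext b b'
        by_cases hb : b = b'
        · subst hb; simp [bptFst, Finset.sum_add_distrib]
        · simp [bptFst, hb])
    rw [hk (fun x => ((Real.log (m' x + Fintype.card A * d) : ℝ) : ℂ)), tr_extB, bptSnd_ptA,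
      hk2 (fun x => ((Real.log (m x + d) : ℝ) : ℂ)), tr_extAB] at h
    rw [hdAB, hdB, tr_self V' _ (fun x => Real.log (m' x + Fintype.card A * d)) hV',
      tr_self V _ (fun x => Real.log (m x + d)) hV] at h
    exact h
  have L1 := (limB m' (Fintype.card A : ℝ)).const_sub (∑ j, l' j * Real.log (l' j))
  have L2 := (limB m 1).const_sub (∑ j, l j * Real.log (l j))
  have := le_of_tendsto_of_tendsto L1 L2 (by
    filter_upwards [self_mem_nhdsWithin] with d hd
    simpa using key d hd)
  linarith

end ext

end SSA

/-- A quantum Markov chain (an invertible tripartite density operator with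
vanishing conditional mutual information `I(A:C|B) = 0`) maximizes the von Neumann entropy
among all density operators with the same two bipartite marginals `ρ_AB`, `ρ_BC`. -/
theorem qmc_is_max_entropy {A B C : Type*} [Fintype A] [Fintype B] [Fintype C]
    [DecidableEq A] [DecidableEq B] [DecidableEq C]
    (ρ : Matrix (A × B × C) (A × B × C) ℂ) (hρ : IsDensity ρ) (hρinv : IsUnit ρ)
    (hqmc : qcmi ρ = 0) :
    ∀ σ : Matrix (A × B × C) (A × B × C) ℂ, IsDensity σ →
      ptC σ = ptC ρ → ptA σ = ptA ρ → vnEntropy σ ≤ vnEntropy ρ := by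
  intro σ hσ h1 h2
  have hne : Nonempty A := by
    by_contra hA
    rw [not_nonempty_iff] at hA
    have := hσ.2
    simp [Matrix.trace] at this
  have h := SSA.ssa σ hσ.1
  have hB : ptAC σ = ptAC ρ := by rw [← SSA.bptFst_ptC, h1, SSA.bptFst_ptC]
  rw [h1, h2, hB] at h
  unfold qcmi at hqmc
  linarith
end

section
/- Let ρ_ABC be an invertible density operator on H_A⊗H_B⊗H_C with I_{ρ_ABC}(A:C|B) = 0, and let ρ_AB, ρ_BC, ρ_B be its marginals. Then ρ_ABC = ρ_BC^{1/2} ρ_B^{−1/2} ρ_AB ρ_B^{−1/2} ρ_BC^{1/2}, where each operator is extended to H_A⊗H_B⊗H_C by tensoring with identities on the remaining factors; that is, the Petz recovery map P_{B→BC}(X) = ρ_BC^{1/2} ρ_B^{−1/2} X ρ_B^{−1/2} ρ_BC^{1/2} applied to ρ_AB recovers ρ_ABC exactly. -/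
open scoped Matrix ComplexOrder

variable {A B C : Type*}

lemma aux_pf {M : Type*} [Fintype M] (μ : M → ℝ) (hμ : ∀ j, 0 < μ j) (c : M → ℂ)
    (h : ∀ t : ℝ, 0 < t → ∑ j, c j / ((μ j + t : ℝ) : ℂ) = 0) (g : ℝ → ℂ) :
    ∑ j, c j * g (μ j) = 0 := by
  classical
  set s : Finset ℝ := Finset.univ.image μ with hs
  have hmem : ∀ j ∈ (Finset.univ : Finset M), μ j ∈ s := fun j hj =>
    Finset.mem_image_of_mem _ hj
  set c' : ℝ → ℂ := fun m => ∑ j with μ j = m, c j with hc'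
  have hfib : ∀ g : ℝ → ℂ, ∑ j, c j * g (μ j) = ∑ m ∈ s, c' m * g m := by
    intro g
    rw [← Finset.sum_fiberwise_of_maps_to hmem]
    refine Finset.sum_congr rfl fun m _ => ?_
    rw [hc', Finset.sum_mul]
    refine Finset.sum_congr rfl fun j hj => ?_
    rw [(Finset.mem_filter.1 hj).2]
  have hspos : ∀ m ∈ s, 0 < m := by
    intro m hm
    obtain ⟨j, _, rfl⟩ := Finset.mem_image.1 hm
    exact hμ j
  let P : Polynomial ℂ := ∑ m ∈ s, Polynomial.C (c' m) *
    ∏ ν ∈ s.erase m, (Polynomial.X + Polynomial.C (ν : ℂ))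
  have hPt : ∀ t : ℝ, 0 < t → P.eval (t : ℂ) = 0 := by
    intro t ht
    have h1 := h t ht
    have h2 := hfib (fun m => (((m + t : ℝ) : ℂ))⁻¹)
    simp only [← div_eq_mul_inv] at h2
    rw [h1] at h2
    have : P.eval (t : ℂ) = (∏ ν ∈ s, ((t : ℂ) + ν)) * ∑ m ∈ s, c' m / ((m + t : ℝ) : ℂ) := by
      simp only [P, Polynomial.eval_finsetSum, Polynomial.eval_mul, Polynomial.eval_C,
        Polynomial.eval_prod, Polynomial.eval_add, Polynomial.eval_X]
      rw [Finset.mul_sum]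
      refine Finset.sum_congr rfl fun m hm => ?_
      rw [← Finset.mul_prod_erase s _ hm]
      have : ((m + t : ℝ) : ℂ) ≠ 0 := by
        exact_mod_cast (add_pos (hspos m hm) ht).ne'
      push_cast at this ⊢
      have h3 : (t : ℂ) + m ≠ 0 := by rwa [add_comm]
      field_simp
      ring
    rw [this, ← h2, mul_zero]
  have hP : P = 0 := by
    refine Polynomial.eq_zero_of_infinite_isRoot P ?_
    refine Set.Infinite.mono (s := (fun t : ℝ => (t : ℂ)) '' Set.Ioi 0) ?_ ?_
    · rintro _ ⟨t, ht, rfl⟩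
      exact hPt t ht
    · exact (Set.Ioi_infinite 0).image (Complex.ofReal_injective.injOn)
  rw [hfib]
  refine Finset.sum_eq_zero fun m hm => ?_
  have h4 : P.eval (-(m : ℂ)) = c' m * ∏ ν ∈ s.erase m, (-(m : ℂ) + ν) := by
    simp only [P, Polynomial.eval_finsetSum, Polynomial.eval_mul, Polynomial.eval_C,
        Polynomial.eval_prod, Polynomial.eval_add, Polynomial.eval_X]
    refine Finset.sum_eq_single_of_mem m hm fun b hb hbm => ?_
    rw [Finset.prod_eq_zero (Finset.mem_erase.2 ⟨hbm.symm, hm⟩) (by simp), mul_zero]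
  rw [hP, Polynomial.eval_zero] at h4
  have h5 : ∏ ν ∈ s.erase m, (-(m : ℂ) + ν) ≠ 0 := by
    refine Finset.prod_ne_zero_iff.2 fun ν hν h6 => (Finset.mem_erase.1 hν).1 ?_
    have : (ν : ℂ) = m := by linear_combination h6
    exact_mod_cast this
  rw [(mul_eq_zero.1 h4.symm).resolve_right h5, zero_mul]

lemma aux_log {ι : Type*} [Fintype ι] (c l : ι → ℝ) (hl : ∀ i, 0 < l i)
    (h0 : ∑ i, c i = 0) (h1 : ∑ i, c i * Real.log (l i) = 0)
    (hg : ∀ t : ℝ, 0 < t → 0 ≤ ∑ i, c i / (l i + t)) :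
    ∀ t : ℝ, 0 < t → ∑ i, c i / (l i + t) = 0 := by
  set G : ℝ → ℝ := fun t => ∑ i, c i * Real.log (l i + t) with hG
  have hd : ∀ t : ℝ, 0 ≤ t → HasDerivAt G (∑ i, c i / (l i + t)) t := by
    intro t ht
    refine HasDerivAt.fun_sum fun i _ => ?_
    have := ((hasDerivAt_id t).const_add (l i)).log (by have := hl i; simp; positivity)
    simpa [div_eq_mul_inv] using this.const_mul (c i)
  have hmono : MonotoneOn G (Set.Ici 0) := by
    refine monotoneOn_of_deriv_nonneg (convex_Ici 0)
      (fun t ht => (hd t ht).continuousAt.continuousWithinAt) ?_ ?_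
    · intro t ht
      rw [interior_Ici] at ht
      exact (hd t ht.le).differentiableAt.differentiableWithinAt
    · intro t ht
      rw [interior_Ici] at ht
      rw [(hd t ht.le).deriv]
      exact hg t ht
  have hlim : Filter.Tendsto G Filter.atTop (nhds 0) := by
    have e : (fun t : ℝ => ∑ i, c i * Real.log (l i / t + 1)) =ᶠ[Filter.atTop] G := by
      filter_upwards [Filter.eventually_gt_atTop 0] with t ht
      have : ∀ i, Real.log (l i / t + 1) = Real.log (l i + t) - Real.log t := by
        intro i
        rw [← Real.log_div (add_pos (hl i) ht).ne' ht.ne']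
        congr 1
        field_simp
      simp only [this, mul_sub, Finset.sum_sub_distrib, ← Finset.sum_mul, h0, hG]
      ring
    refine Filter.Tendsto.congr' e ?_
    have : Filter.Tendsto (fun t : ℝ => ∑ i, c i * Real.log (l i / t + 1)) Filter.atTop
        (nhds (∑ i, c i * Real.log (0 + 1))) := by
      refine tendsto_finsetSum _ fun i _ => Filter.Tendsto.const_mul _ ?_
      refine Filter.Tendsto.log ?_ (by norm_num)
      exact (Filter.Tendsto.div_atTop tendsto_const_nhds Filter.tendsto_id).add_const 1
    simpa using this
  have hG0 : G 0 = 0 := by simpa [hG] using h1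
  have hz : ∀ t, 0 ≤ t → G t = 0 := by
    intro t ht
    apply le_antisymm
    · refine ge_of_tendsto hlim ?_
      filter_upwards [Filter.eventually_ge_atTop t] with u hu
      exact hmono ht (ht.trans hu : (0:ℝ) ≤ u) hu
    · rw [← hG0]
      exact hmono (le_refl (0:ℝ)) ht ht
  intro t ht
  have e : G =ᶠ[nhds t] fun _ => 0 := by
    filter_upwards [Ioi_mem_nhds ht] with u hu
    exact hz u (le_of_lt hu)
  have := (hd t ht.le).congr_of_eventuallyEq e.symm
  exact this.unique (hasDerivAt_const t 0)

lemma aux_abs {N M : Type*} [Fintype N] [Fintype M] (d : N → ℝ) (d0 : M → ℝ)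
    (hd : ∀ i, 0 < d i) (hd0 : ∀ j, 0 < d0 j)
    (V : (M → ℂ) →ₗ[ℂ] (N → ℂ))
    (hV : ∀ y y', ∑ i, star (V y i) * V y' i = ∑ j, star (y j) * y' j)
    (hVd : ∀ y, ∑ i, (d i : ℂ) * (star (V y i) * V y i) = ∑ j, (d0 j : ℂ) * (star (y j) * y j))
    (v0 : M → ℂ)
    (hlog : ∑ i, (Real.log (d i) : ℂ) * (star (V v0 i) * V v0 i)
      = ∑ j, (Real.log (d0 j) : ℂ) * (star (v0 j) * v0 j)) (f : ℝ → ℂ) :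
    (fun i => f (d i) * V v0 i) = V (fun j => f (d0 j) * v0 j) := by
  classical
  set v := V v0 with hv
  have key : ∀ t : ℝ, 0 < t →
      ∑ i, ((d i + t : ℝ) : ℂ) * (star (v i / ((d i + t : ℝ) : ℂ)
          - V (fun j => v0 j / ((d0 j + t : ℝ) : ℂ)) i) * (v i / ((d i + t : ℝ) : ℂ)
          - V (fun j => v0 j / ((d0 j + t : ℝ) : ℂ)) i))
      = ∑ i, star (v i) * v i / ((d i + t : ℝ) : ℂ)
        - ∑ j, star (v0 j) * v0 j / ((d0 j + t : ℝ) : ℂ) := by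
    intro t ht
    set u : M → ℂ := fun j => v0 j / ((d0 j + t : ℝ) : ℂ) with hu
    have hn : ∀ i, ((d i + t : ℝ) : ℂ) ≠ 0 := fun i => by
      exact_mod_cast (add_pos (hd i) ht).ne'
    have hn0 : ∀ i, ((d0 i + t : ℝ) : ℂ) ≠ 0 := fun i => by
      exact_mod_cast (add_pos (hd0 i) ht).ne'
    have e1 : ∑ i, star (v i) * V u i = ∑ j, star (v0 j) * v0 j / ((d0 j + t : ℝ) : ℂ) := by
      rw [hv, hV]
      refine Finset.sum_congr rfl fun j _ => ?_
      simp only [hu]; ring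
    have e2 : ∑ i, star (V u i) * v i = ∑ j, star (v0 j) * v0 j / ((d0 j + t : ℝ) : ℂ) := by
      rw [hv, hV]
      refine Finset.sum_congr rfl fun j _ => ?_
      simp only [hu, star_div₀, Complex.star_def, Complex.conj_ofReal]; ring
    have e3 : ∑ i, ((d i + t : ℝ) : ℂ) * (star (V u i) * V u i)
        = ∑ j, star (v0 j) * v0 j / ((d0 j + t : ℝ) : ℂ) := by
      have : ∑ i, ((d i + t : ℝ) : ℂ) * (star (V u i) * V u i)
        = ∑ j, ((d0 j + t : ℝ) : ℂ) * (star (u j) * u j) := by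
        simp only [Complex.ofReal_add, add_mul, Finset.sum_add_distrib, hVd, ← Finset.mul_sum, hV]
      rw [this]
      refine Finset.sum_congr rfl fun j _ => ?_
      have := hn0 j
      simp only [hu, star_div₀, Complex.star_def, Complex.conj_ofReal]
      field_simp
    have e4 : ∀ i, ((d i + t : ℝ) : ℂ) * (star (v i / ((d i + t : ℝ) : ℂ) - V u i) *
        (v i / ((d i + t : ℝ) : ℂ) - V u i))
        = star (v i) * v i / ((d i + t : ℝ) : ℂ) - star (v i) * V u i - star (V u i) * v i
          + ((d i + t : ℝ) : ℂ) * (star (V u i) * V u i) := by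
      intro i
      have := hn i
      simp only [star_sub, star_div₀, Complex.star_def, Complex.conj_ofReal]
      field_simp
      ring
    simp only [e4, Finset.sum_add_distrib, Finset.sum_sub_distrib, e1, e2, e3]
    ring
  have nsq : ∀ z : ℂ, star z * z = ((Complex.normSq z : ℝ) : ℂ) := fun z => by
    rw [mul_comm]; exact Complex.mul_conj z
  simp only [nsq] at key
  have keyR : ∀ t : ℝ, 0 < t →
      ∑ i, (d i + t) * Complex.normSq (v i / ((d i + t : ℝ) : ℂ)
          - V (fun j => v0 j / ((d0 j + t : ℝ) : ℂ)) i)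
      = ∑ k : N ⊕ M, Sum.elim (fun i => Complex.normSq (v i)) (fun j => - Complex.normSq (v0 j)) k
        / (Sum.elim d d0 k + t) := by
    intro t ht
    have := key t ht
    rw [Fintype.sum_sum_type]
    simp only [Sum.elim_inl, Sum.elim_inr, neg_div, Finset.sum_neg_distrib, ← sub_eq_add_neg]
    exact_mod_cast this
  have hzero := aux_log (Sum.elim (fun i => Complex.normSq (v i))
      (fun j => - Complex.normSq (v0 j))) (Sum.elim d d0) (by rintro (i | j) <;> simp [hd, hd0])
      (by
        have := hV v0 v0
        simp only [nsq] at this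
        have h2 : ∑ i, Complex.normSq (v i) = ∑ j, Complex.normSq (v0 j) := by exact_mod_cast this
        rw [Fintype.sum_sum_type]
        simp [h2])
      (by
        simp only [nsq] at hlog
        have h2 : ∑ i, Real.log (d i) * Complex.normSq (v i)
          = ∑ j, Real.log (d0 j) * Complex.normSq (v0 j) := by exact_mod_cast hlog
        rw [Fintype.sum_sum_type]
        simp only [Sum.elim_inl, Sum.elim_inr, neg_mul, Finset.sum_neg_distrib]
        simp only [mul_comm (Complex.normSq _), h2]
        ring)
      (by
        intro t ht
        rw [← keyR t ht]
        exact Finset.sum_nonneg fun i _ =>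
          mul_nonneg (add_pos (hd i) ht).le (Complex.normSq_nonneg _))
  have hw : ∀ t : ℝ, 0 < t → ∀ i, v i / ((d i + t : ℝ) : ℂ)
          - V (fun j => v0 j / ((d0 j + t : ℝ) : ℂ)) i = 0 := by
    intro t ht i
    have h1 := hzero t ht
    rw [← keyR t ht, Finset.sum_eq_zero_iff_of_nonneg (fun i _ =>
          mul_nonneg (add_pos (hd i) ht).le (Complex.normSq_nonneg _))] at h1
    have := h1 i (Finset.mem_univ _)
    exact Complex.normSq_eq_zero.1 ((mul_eq_zero.1 this).resolve_left (add_pos (hd i) ht).ne')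
  have hVs : ∀ (y : M → ℂ) i, V y i = ∑ j, V (Pi.single j 1) i * y j := by
    intro y i
    conv_lhs => rw [pi_eq_sum_univ' y]
    rw [map_sum, Finset.sum_apply]
    refine Finset.sum_congr rfl fun j _ => ?_
    rw [map_smul, Pi.smul_apply, smul_eq_mul, mul_comm]
  funext i
  have := aux_pf (Option.elim · (d i) d0) (by rintro (_ | j) <;> simp [hd, hd0])
    (fun o : Option M => o.elim (v i) (fun j => -(V (Pi.single j 1) i * v0 j)))
    (by
      intro t ht
      have := hw t ht i
      rw [hVs] at this
      rw [Fintype.sum_option]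
      simp only [Option.elim_none, Option.elim_some, neg_div, Finset.sum_neg_distrib,
        ← sub_eq_add_neg]
      rw [← this]
      simp only [mul_div_assoc]) f
  rw [Fintype.sum_option] at this
  simp only [Option.elim_none, Option.elim_some, neg_mul, Finset.sum_neg_distrib,
        ← sub_eq_add_neg] at this
  rw [hVs, mul_comm, sub_eq_zero.1 this]
  refine Finset.sum_congr rfl fun j _ => ?_
  ring

/-- Real diagonal matrix, viewed as a complex matrix. -/
noncomputable def auxD {n : Type*} [DecidableEq n] (f : n → ℝ) : Matrix n n ℂ :=
  Matrix.diagonal (fun i => (f i : ℂ))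

lemma auxD_star {n : Type*} [DecidableEq n] (f : n → ℝ) : (auxD f)ᴴ = auxD f := by
  rw [auxD, Matrix.diagonal_conjTranspose]
  congr 1
  funext i
  simp

lemma auxD_mul {n : Type*} [Fintype n] [DecidableEq n] (f g : n → ℝ) :
    auxD f * auxD g = auxD (fun i => f i * g i) := by
  simp [auxD, Matrix.diagonal_mul_diagonal]

lemma auxD_one {n : Type*} [DecidableEq n] : auxD (fun _ : n => (1 : ℝ)) = 1 := by
  simp [auxD]

lemma aux_tr {n m : Type*} [Fintype n] [DecidableEq n] [Fintype m] [DecidableEq m] (a : n → ℝ)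
    (b : m → ℝ) (X Y : Matrix n m ℂ) :
    ∑ p : n × m, ((a p.1 * b p.2 : ℝ) : ℂ) * (star (X p.1 p.2) * Y p.1 p.2)
      = (auxD b * Xᴴ * auxD a * Y).trace := by
  simp only [Matrix.trace, Matrix.diag, Matrix.mul_apply (N := Y)]
  rw [Fintype.sum_prod_type, Finset.sum_comm]
  refine Finset.sum_congr rfl fun j _ => Finset.sum_congr rfl fun i _ => ?_
  simp only [auxD, Matrix.mul_diagonal, Matrix.diagonal_mul, Matrix.conjTranspose_apply]
  push_cast
  ring

lemma aux_ent {k : Type*} [Fintype k] [DecidableEq k] (x l : k → ℝ) (hx : ∀ i, 0 < x i)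
    (hl : ∀ i, 0 < l i) (Q L : Matrix k k ℂ) (hQ : Qᴴ * Q = 1) (hL : L * Lᴴ = 1) :
    ∑ p : k × k, (Real.log (l p.1 / x p.2) : ℂ) *
      (star ((Lᴴ * Q * auxD (fun i => √(x i))) p.1 p.2) *
        (Lᴴ * Q * auxD (fun i => √(x i))) p.1 p.2)
    = (L * auxD (fun i => Real.log (l i)) * Lᴴ * (Q * auxD x * Qᴴ)).trace
      - (auxD (fun i => x i * Real.log (x i))).trace := by
  set X := Lᴴ * Q * auxD (fun i => √(x i)) with hX
  have xx : auxD (fun i => √(x i)) * auxD (fun i => √(x i)) = auxD x := by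
    rw [auxD_mul]; congr 1; funext i; exact Real.mul_self_sqrt (hx i).le
  have hXs : Xᴴ = auxD (fun i => √(x i)) * (Qᴴ * L) := by
    simp only [hX, Matrix.conjTranspose_mul, Matrix.conjTranspose_conjTranspose, auxD_star]
  have h1 := aux_tr (fun i => Real.log (l i)) (fun _ : k => (1:ℝ)) X X
  have h2 := aux_tr (fun _ : k => (1:ℝ)) (fun i => Real.log (x i)) X X
  have e1 : (auxD (fun _ : k => (1:ℝ)) * Xᴴ * auxD (fun i => Real.log (l i)) * X).trace
    = (L * auxD (fun i => Real.log (l i)) * Lᴴ * (Q * auxD x * Qᴴ)).trace := by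
    have e2 : auxD (fun _ : k => (1:ℝ)) * Xᴴ * auxD (fun i => Real.log (l i)) * X
      = (auxD (fun i => √(x i)) * Qᴴ) * (L * auxD (fun i => Real.log (l i)) * Lᴴ *
        (Q * auxD (fun i => √(x i)))) := by
      rw [hXs, hX, auxD_one]; simp only [mul_assoc, one_mul]
    rw [e2, Matrix.trace_mul_comm, ← xx]
    simp only [mul_assoc]
  have e3 : auxD (fun i => Real.log (x i)) * Xᴴ * auxD (fun _ : k => (1:ℝ)) * X
      = auxD (fun i => x i * Real.log (x i)) := by
    have : Xᴴ * X = auxD x := by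
      rw [hXs, hX, ← xx]
      have : auxD (fun i => √(x i)) * (Qᴴ * L) * (Lᴴ * Q * auxD fun i => √(x i))
        = auxD (fun i => √(x i)) * (Qᴴ * ((L * Lᴴ) * Q) * auxD fun i => √(x i)) := by
        simp only [mul_assoc]
      rw [this, hL, one_mul, hQ, one_mul]
    rw [auxD_one, mul_one, mul_assoc, this, auxD_mul]
    congr 1; funext i; ring
  rw [e1] at h1
  rw [e3] at h2
  rw [← h1, ← h2, ← Finset.sum_sub_distrib]
  refine Finset.sum_congr rfl fun p _ => ?_
  rw [Real.log_div (hl _).ne' (hx _).ne']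
  push_cast
  ring

lemma aux_mid {n m : Type*} [Fintype n] [DecidableEq n] [Fintype m] [DecidableEq m]
    (E : Matrix m m ℂ →ₗ[ℂ] Matrix n n ℂ) (hmul : ∀ X Y, E (X * Y) = E X * E Y)
    (hstar : ∀ X, E Xᴴ = (E X)ᴴ) (hone : E 1 = 1)
    (R S : Matrix n n ℂ) (R0 S0 : Matrix m m ℂ) (r s : n → ℝ) (r0 s0 : m → ℝ)
    (hR : Rᴴ * R = 1) (hS : Sᴴ * S = 1) (hR0 : R0ᴴ * R0 = 1) (hS0 : S0ᴴ * S0 = 1)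
    (hr : ∀ i, 0 < r i) (hs : ∀ i, 0 < s i) (hr0 : ∀ i, 0 < r0 i) (hs0 : ∀ i, 0 < s0 i)
    (hρ : ∀ X, (E X * (R * auxD r * Rᴴ)).trace = (X * (R0 * auxD r0 * R0ᴴ)).trace)
    (hσ : ∀ X, (E X * (S * auxD s * Sᴴ)).trace = (X * (S0 * auxD s0 * S0ᴴ)).trace)
    (hlog : (S * auxD (fun i => Real.log (s i)) * Sᴴ * (R * auxD r * Rᴴ)).trace
        - (auxD (fun i => r i * Real.log (r i))).trace
      = (S0 * auxD (fun i => Real.log (s0 i)) * S0ᴴ * (R0 * auxD r0 * R0ᴴ)).trace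
        - (auxD (fun i => r0 i * Real.log (r0 i))).trace) :
    S * auxD (fun i => √(s i)) * Sᴴ =
      E (S0 * auxD (fun i => √(s0 i)) * S0ᴴ * (R0 * auxD (fun i => (√(r0 i))⁻¹) * R0ᴴ)) *
        (R * auxD (fun i => √(r i)) * Rᴴ) := by
  have hR' : R * Rᴴ = 1 := mul_eq_one_comm.1 hR
  have hS' : S * Sᴴ = 1 := mul_eq_one_comm.1 hS
  have hR0' : R0 * R0ᴴ = 1 := mul_eq_one_comm.1 hR0
  have hS0' : S0 * S0ᴴ = 1 := mul_eq_one_comm.1 hS0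
  have cR : ∀ Z : Matrix n n ℂ, Rᴴ * (R * Z) = Z := fun Z => by rw [← mul_assoc, hR, one_mul]
  have cS : ∀ Z : Matrix n n ℂ, Sᴴ * (S * Z) = Z := fun Z => by rw [← mul_assoc, hS, one_mul]
  have cR' : ∀ Z : Matrix n n ℂ, R * (Rᴴ * Z) = Z := fun Z => by rw [← mul_assoc, hR', one_mul]
  have cS' : ∀ Z : Matrix n n ℂ, S * (Sᴴ * Z) = Z := fun Z => by rw [← mul_assoc, hS', one_mul]
  have cR0 : ∀ Z : Matrix m m ℂ, R0ᴴ * (R0 * Z) = Z := fun Z => by rw [← mul_assoc, hR0, one_mul]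
  have cS0 : ∀ Z : Matrix m m ℂ, S0ᴴ * (S0 * Z) = Z := fun Z => by rw [← mul_assoc, hS0, one_mul]
  have cR0' : ∀ Z : Matrix m m ℂ, R0 * (R0ᴴ * Z) = Z := fun Z => by
    rw [← mul_assoc, hR0', one_mul]
  have cS0' : ∀ Z : Matrix m m ℂ, S0 * (S0ᴴ * Z) = Z := fun Z => by
    rw [← mul_assoc, hS0', one_mul]
  set w : Matrix n n ℂ := auxD (fun i => √(r i)) with hw
  set q : Matrix m m ℂ := auxD (fun i => (√(r0 i))⁻¹) with hq
  have ww : w * w = auxD r := by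
    rw [hw, auxD_mul]; congr 1; funext i; exact Real.mul_self_sqrt (hr i).le
  have wiw : w * (auxD (fun i => (r i)⁻¹) * w) = 1 := by
    rw [hw, auxD_mul, auxD_mul, ← auxD_one]; congr 1; funext i
    have := Real.mul_self_sqrt (hr i).le
    have h2 := (hr i).ne'
    field_simp
    rw [sq]; exact this
  have qq : q * q = auxD (fun i => (r0 i)⁻¹) := by
    rw [hq, auxD_mul]; congr 1; funext i
    rw [← mul_inv, Real.mul_self_sqrt (hr0 i).le]
  have qrq : q * (auxD r0 * q) = 1 := by
    rw [hq, auxD_mul, auxD_mul, ← auxD_one]; congr 1; funext i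
    have := Real.mul_self_sqrt (hr0 i).le
    have h2 := (Real.sqrt_pos.2 (hr0 i)).ne'
    field_simp
    rw [sq]; exact this.symm
  have wst : wᴴ = w := auxD_star _
  have qst : qᴴ = q := auxD_star _
  -- the isometry
  let P : Matrix m m ℂ → Matrix m m ℂ := fun Y => S0 * Y * (q * R0ᴴ)
  let T : Matrix m m ℂ → Matrix n n ℂ := fun Y => Sᴴ * E (P Y) * (R * w)
  let V : (m × m → ℂ) →ₗ[ℂ] (n × n → ℂ) :=
    { toFun := fun y p => T (Matrix.of fun i j => y (i, j)) p.1 p.2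
      map_add' := by
        intro x y
        have : (Matrix.of fun i j => (x + y) (i, j) : Matrix m m ℂ)
          = (Matrix.of fun i j => x (i, j)) + Matrix.of fun i j => y (i, j) := rfl
        funext p
        rw [this]
        simp only [T, P, mul_add, add_mul, map_add, Pi.add_apply, Matrix.add_apply]
      map_smul' := by
        intro c y
        have : (Matrix.of fun i j => (c • y) (i, j) : Matrix m m ℂ)
          = c • (Matrix.of fun i j => y (i, j)) := rfl
        funext p
        rw [this]
        simp only [T, P, Matrix.mul_smul, Matrix.smul_mul, map_smul, Pi.smul_apply,
          Matrix.smul_apply, RingHom.id_apply] }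
  have Vdef : ∀ Y : Matrix m m ℂ, V (fun p => Y p.1 p.2) = fun p => T Y p.1 p.2 := fun Y => rfl
  have Tst : ∀ Y, (T Y)ᴴ = w * Rᴴ * (E (P Y)ᴴ * S) := by
    intro Y
    simp only [T, Matrix.conjTranspose_mul, Matrix.conjTranspose_conjTranspose, wst, hstar,
      mul_assoc]
  have Pst : ∀ Y, (P Y)ᴴ = R0 * (q * (Yᴴ * S0ᴴ)) := by
    intro Y
    simp only [P, Matrix.conjTranspose_mul, Matrix.conjTranspose_conjTranspose, qst, mul_assoc]
  have iso : ∀ Y Y' : Matrix m m ℂ, ((T Y)ᴴ * T Y').trace = (Yᴴ * Y').trace := by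
    intro Y Y'
    have e1 : (T Y)ᴴ * T Y' = (w * Rᴴ) * (E ((P Y)ᴴ * P Y') * (R * w)) := by
      rw [Tst, hmul]; simp only [T, mul_assoc, cS']
    have e2 : E ((P Y)ᴴ * P Y') * (R * w) * (w * Rᴴ)
        = E ((P Y)ᴴ * P Y') * (R * auxD r * Rᴴ) := by
      rw [← ww]; simp only [mul_assoc]
    rw [e1, Matrix.trace_mul_comm, e2, hρ, Pst]
    have e3 : R0 * (q * (Yᴴ * S0ᴴ)) * P Y' * (R0 * auxD r0 * R0ᴴ)
        = (R0 * q) * (Yᴴ * Y' * (q * (auxD r0 * R0ᴴ))) := by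
      simp only [P, mul_assoc, cS0, cR0]
    rw [e3, Matrix.trace_mul_comm]
    have e4 : Yᴴ * Y' * (q * (auxD r0 * R0ᴴ)) * (R0 * q) = Yᴴ * Y' * (q * (auxD r0 * q)) := by
      simp only [mul_assoc, cR0]
    rw [e4, qrq, mul_one]
  have isod : ∀ Y : Matrix m m ℂ, (auxD (fun i => (r i)⁻¹) * (T Y)ᴴ * auxD s * T Y).trace
      = (auxD (fun i => (r0 i)⁻¹) * Yᴴ * auxD s0 * Y).trace := by
    intro Y
    have e1 : auxD (fun i => (r i)⁻¹) * (T Y)ᴴ * auxD s * T Y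
        = (auxD (fun i => (r i)⁻¹) * (w * Rᴴ)) *
          (E (P Y)ᴴ * (S * auxD s * Sᴴ) * E (P Y) * (R * w)) := by
      rw [Tst]; simp only [T, mul_assoc]
    have e2 : (E (P Y)ᴴ * (S * auxD s * Sᴴ) * E (P Y) * (R * w)) *
        (auxD (fun i => (r i)⁻¹) * (w * Rᴴ)) = E (P Y)ᴴ * (S * auxD s * Sᴴ) * E (P Y) := by
      have : R * w * (auxD (fun i => (r i)⁻¹) * (w * Rᴴ))
        = R * (w * (auxD (fun i => (r i)⁻¹) * w)) * Rᴴ := by simp only [mul_assoc]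
      rw [mul_assoc (E (P Y)ᴴ * (S * auxD s * Sᴴ) * E (P Y)), this, wiw, mul_one, hR', mul_one]
    rw [e1, Matrix.trace_mul_comm, e2, Matrix.trace_mul_comm, ← mul_assoc, ← hmul, hσ, Pst]
    have e3 : P Y * (R0 * (q * (Yᴴ * S0ᴴ))) * (S0 * auxD s0 * S0ᴴ)
        = (S0 * Y) * (auxD (fun i => (r0 i)⁻¹) * Yᴴ * auxD s0 * S0ᴴ) := by
      rw [← qq]; simp only [P, mul_assoc, cS0, cR0]
    rw [e3, Matrix.trace_mul_comm]
    simp only [mul_assoc, cS0]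
  set Y0 : Matrix m m ℂ := S0ᴴ * R0 * auxD (fun i => √(r0 i)) with hY0
  have sqi : auxD (fun i => √(r0 i)) * q = 1 := by
    rw [hq, auxD_mul, ← auxD_one]; congr 1; funext i
    exact mul_inv_cancel₀ (Real.sqrt_pos.2 (hr0 i)).ne'
  have TY0 : T Y0 = Sᴴ * R * w := by
    have : P Y0 = 1 := by
      have : P Y0 = S0 * (S0ᴴ * (R0 * ((auxD (fun i => √(r0 i)) * q) * R0ᴴ))) := by
        simp only [P, hY0, mul_assoc]
      rw [this, sqi, one_mul, hR0', mul_one, hS0']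
    simp only [T, this, hone, mul_one, one_mul, mul_assoc]
  have main := aux_abs (fun p : n × n => s p.1 / r p.2) (fun p : m × m => s0 p.1 / r0 p.2)
    (fun p => div_pos (hs _) (hr _)) (fun p => div_pos (hs0 _) (hr0 _)) V
    (by
      intro y y'
      have h1 := aux_tr (fun _ : n => (1:ℝ)) (fun _ : n => (1:ℝ))
        (T (Matrix.of fun i j => y (i, j))) (T (Matrix.of fun i j => y' (i, j)))
      have h2 := aux_tr (fun _ : m => (1:ℝ)) (fun _ : m => (1:ℝ))
        ((Matrix.of fun i j => y (i, j))) ((Matrix.of fun i j => y' (i, j)))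
      simp only [auxD_one, mul_one, one_mul, Complex.ofReal_one] at h1 h2
      rw [iso, ← h2] at h1
      exact h1)
    (by
      intro y
      have h1 := aux_tr s (fun i => (r i)⁻¹)
        (T (Matrix.of fun i j => y (i, j))) (T (Matrix.of fun i j => y (i, j)))
      have h2 := aux_tr s0 (fun i => (r0 i)⁻¹)
        ((Matrix.of fun i j => y (i, j))) ((Matrix.of fun i j => y (i, j)))
      rw [isod, ← h2] at h1
      exact h1)
    (fun p => Y0 p.1 p.2)
    (by
      rw [Vdef, TY0]
      have h1 := aux_ent r s hr hs R S hR hS'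
      have h2 := aux_ent r0 s0 hr0 hs0 R0 S0 hR0 hS0'
      rw [hlog, ← h2] at h1
      exact h1)
    (fun x => ((√x : ℝ) : ℂ))
  rw [Vdef, TY0] at main
  have main2 : auxD (fun i => √(s i)) * (Sᴴ * R) = T (auxD (fun i => √(s0 i)) * (S0ᴴ * R0)) := by
    have l0 : (fun p : m × m => ((√(s0 p.1 / r0 p.2) : ℝ) : ℂ) * Y0 p.1 p.2)
        = fun p => (auxD (fun i => √(s0 i)) * (S0ᴴ * R0)) p.1 p.2 := by
      funext p
      have := (Real.sqrt_pos.2 (hr0 p.2)).ne'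
      have h3 : ((√(r0 p.2) : ℝ) : ℂ) ≠ 0 := by exact_mod_cast this
      simp only [hY0, auxD, Matrix.mul_diagonal, Matrix.diagonal_mul]
      rw [Real.sqrt_div (hs0 _).le]
      push_cast
      field_simp
    have l1 : (fun p : n × n => ((√(s p.1 / r p.2) : ℝ) : ℂ) * (Sᴴ * R * w) p.1 p.2)
        = fun p => (auxD (fun i => √(s i)) * (Sᴴ * R)) p.1 p.2 := by
      funext p
      have := (Real.sqrt_pos.2 (hr p.2)).ne'
      have h3 : ((√(r p.2) : ℝ) : ℂ) ≠ 0 := by exact_mod_cast this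
      simp only [hw, auxD, Matrix.mul_diagonal, Matrix.diagonal_mul]
      rw [Real.sqrt_div (hs _).le]
      push_cast
      field_simp
    rw [l0, l1, Vdef] at main
    ext i j
    exact congrFun main (i, j)
  have fin := congrArg (fun Z => S * Z * Rᴴ) main2
  simp only [T, P, mul_assoc, cS', hR', mul_one] at fin
  simp only [mul_assoc]
  exact fin

lemma aux_spec {n : Type*} [Fintype n] [DecidableEq n] {ρ : Matrix n n ℂ} (h : ρ.IsHermitian) :
    ρ = (h.eigenvectorUnitary : Matrix n n ℂ) * auxD h.eigenvalues *
      (h.eigenvectorUnitary : Matrix n n ℂ)ᴴ := by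
  conv_lhs => rw [h.spectral_theorem, Unitary.conjStarAlgAut_apply]
  rfl

lemma aux_matFun {n : Type*} [Fintype n] [DecidableEq n] (f : ℝ → ℝ) {ρ : Matrix n n ℂ}
    (h : ρ.IsHermitian) :
    matFun f ρ = (h.eigenvectorUnitary : Matrix n n ℂ) * auxD (fun i => f (h.eigenvalues i)) *
      (h.eigenvectorUnitary : Matrix n n ℂ)ᴴ := by
  rw [matFun, dif_pos h]
  rfl

lemma aux_vn {n : Type*} [Fintype n] [DecidableEq n] {ρ : Matrix n n ℂ} (h : ρ.IsHermitian) :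
    ((vnEntropy ρ : ℝ) : ℂ)
      = -(auxD (fun i => h.eigenvalues i * Real.log (h.eigenvalues i))).trace := by
  rw [vnEntropy, dif_pos h, auxD, Matrix.trace_diagonal]
  push_cast
  rfl

lemma aux_unit {n : Type*} [Fintype n] [DecidableEq n] {ρ : Matrix n n ℂ} (h : ρ.IsHermitian) :
    (h.eigenvectorUnitary : Matrix n n ℂ)ᴴ * (h.eigenvectorUnitary : Matrix n n ℂ) = 1 :=
  Unitary.coe_star_mul_self h.eigenvectorUnitary

/-- Trace of `log ρ * ρ` in a spectral decomposition. -/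
lemma aux_trlog {n : Type*} [Fintype n] [DecidableEq n] (U : Matrix n n ℂ) (hU : Uᴴ * U = 1)
    (f e : n → ℝ) :
    (U * auxD f * Uᴴ * (U * auxD e * Uᴴ)).trace = (auxD (fun i => e i * f i)).trace := by
  have e1 : U * auxD f * Uᴴ * (U * auxD e * Uᴴ)
      = U * (auxD f * ((Uᴴ * U) * (auxD e * Uᴴ))) := by simp only [mul_assoc]
  rw [e1, hU, one_mul, Matrix.trace_mul_comm]
  have e2 : auxD f * (auxD e * Uᴴ) * U = auxD f * (auxD e * (Uᴴ * U)) := by simp only [mul_assoc]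
  rw [e2, hU, mul_one, auxD_mul]
  simp only [mul_comm]

lemma aux_fmul {n : Type*} [Fintype n] [DecidableEq n] (U : Matrix n n ℂ) (hU : Uᴴ * U = 1)
    (f g : n → ℝ) :
    U * auxD f * Uᴴ * (U * auxD g * Uᴴ) = U * auxD (fun i => f i * g i) * Uᴴ := by
  have e1 : U * auxD f * Uᴴ * (U * auxD g * Uᴴ)
      = U * (auxD f * ((Uᴴ * U) * (auxD g * Uᴴ))) := by simp only [mul_assoc]
  rw [e1, hU, one_mul, ← auxD_mul]
  simp only [mul_assoc]

lemma aux_fstar {n : Type*} [Fintype n] [DecidableEq n] (U : Matrix n n ℂ) (f : n → ℝ) :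
    (U * auxD f * Uᴴ)ᴴ = U * auxD f * Uᴴ := by
  simp only [Matrix.conjTranspose_mul, Matrix.conjTranspose_conjTranspose, auxD_star, mul_assoc]

lemma aux_fone {n : Type*} [Fintype n] [DecidableEq n] (U : Matrix n n ℂ) (hU : Uᴴ * U = 1)
    (f g : n → ℝ) (h : ∀ i, f i * g i = 1) :
    U * auxD f * Uᴴ * (U * auxD g * Uᴴ) = 1 := by
  rw [aux_fmul U hU]
  simp only [h]
  rw [auxD_one, mul_one]
  exact mul_eq_one_comm.1 hU

lemma aux_fsq {n : Type*} [Fintype n] [DecidableEq n] (U : Matrix n n ℂ) (hU : Uᴴ * U = 1)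
    (f : n → ℝ) (h : ∀ i, 0 < f i) :
    U * auxD (fun i => √(f i)) * Uᴴ * (U * auxD (fun i => √(f i)) * Uᴴ) = U * auxD f * Uᴴ := by
  rw [aux_fmul U hU]
  simp only [fun i => Real.mul_self_sqrt (h i).le]

section auxTri

variable {A B C : Type*} [Fintype A] [Fintype B] [Fintype C]
    [DecidableEq A] [DecidableEq B] [DecidableEq C]

/-- `extAB` as a linear map. -/
noncomputable def auxE : Matrix (A × B) (A × B) ℂ →ₗ[ℂ] Matrix (A × B × C) (A × B × C) ℂ where
  toFun := extAB
  map_add' X Y := by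
    ext x y
    simp only [extAB, Matrix.add_apply]
    ring
  map_smul' c Y := by
    ext x y
    simp only [extAB, Matrix.smul_apply, smul_eq_mul, RingHom.id_apply]
    ring

/-- Tensoring with the identity on the left. -/
noncomputable def auxK {X Y : Type*} [DecidableEq X]
    (M : Matrix Y Y ℂ) : Matrix (X × Y) (X × Y) ℂ :=
  fun x y => (if x.1 = y.1 then 1 else 0) * M x.2 y.2

lemma extBC_eq (M : Matrix (B × C) (B × C) ℂ) : (extBC M : Matrix (A × B × C) _ ℂ) = auxK M := rfl

lemma extB_eq (M : Matrix B B ℂ) :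
    (extB M : Matrix (A × B × C) _ ℂ) = auxE (auxK M) := rfl

lemma auxK_mul {X Y : Type*} [DecidableEq X] [Fintype X] [Fintype Y] (M N : Matrix Y Y ℂ) :
    (auxK (M * N) : Matrix (X × Y) _ ℂ) = auxK M * auxK N := by
  ext x y
  simp only [auxK, Matrix.mul_apply, Fintype.sum_prod_type, Finset.mul_sum]
  rw [Finset.sum_comm]
  refine Finset.sum_congr rfl fun z _ => ?_
  simp [Finset.sum_ite_eq]

lemma auxK_star {X Y : Type*} [DecidableEq X] (M : Matrix Y Y ℂ) :
    (auxK Mᴴ : Matrix (X × Y) _ ℂ) = (auxK M)ᴴ := by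
  ext x y
  simp only [auxK, Matrix.conjTranspose_apply, eq_comm (a := x.1)]
  split_ifs <;> simp

lemma auxK_D {X Y : Type*} [DecidableEq X] [DecidableEq Y] (f : Y → ℝ) :
    (auxK (auxD f) : Matrix (X × Y) _ ℂ) = auxD (fun p => f p.2) := by
  ext x y
  simp only [auxK, auxD, Matrix.diagonal_apply, Prod.ext_iff]
  split_ifs <;> simp_all

lemma auxK_one {X Y : Type*} [DecidableEq X] [DecidableEq Y] :
    (auxK 1 : Matrix (X × Y) (X × Y) ℂ) = 1 := by
  rw [← auxD_one, ← auxD_one, auxK_D]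

lemma auxE_mul (M N : Matrix (A × B) (A × B) ℂ) :
    (auxE (M * N) : Matrix (A × B × C) _ ℂ) = auxE M * auxE N := by
  ext x y
  simp only [auxE, LinearMap.coe_mk, AddHom.coe_mk, extAB, Matrix.mul_apply,
    Fintype.sum_prod_type, Finset.sum_mul]
  refine Finset.sum_congr rfl fun a _ => Finset.sum_congr rfl fun b _ => ?_
  simp [Finset.sum_ite_eq]

lemma auxE_star (M : Matrix (A × B) (A × B) ℂ) :
    (auxE Mᴴ : Matrix (A × B × C) _ ℂ) = (auxE M)ᴴ := by
  ext x y
  simp only [auxE, LinearMap.coe_mk, AddHom.coe_mk, extAB, Matrix.conjTranspose_apply,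
    eq_comm (a := x.2.2)]
  split_ifs <;> simp

lemma auxE_one : (auxE 1 : Matrix (A × B × C) (A × B × C) ℂ) = 1 := by
  ext x y
  simp only [auxE, LinearMap.coe_mk, AddHom.coe_mk, extAB, Matrix.one_apply, Prod.ext_iff]
  split_ifs <;> simp_all

lemma auxE_trace (X : Matrix (A × B) (A × B) ℂ) (ρ : Matrix (A × B × C) (A × B × C) ℂ) :
    (auxE X * ρ).trace = (X * ptC ρ).trace := by
  simp only [auxE, LinearMap.coe_mk, AddHom.coe_mk, extAB, Matrix.trace, Matrix.diag,
    Matrix.mul_apply, Fintype.sum_prod_type, ptC, Finset.mul_sum]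
  refine Finset.sum_congr rfl fun a _ => Finset.sum_congr rfl fun b _ => ?_
  rw [Finset.sum_comm]
  refine Finset.sum_congr rfl fun a' _ => ?_
  rw [Finset.sum_comm]
  refine Finset.sum_congr rfl fun b' _ => ?_
  simp [Finset.sum_ite_eq]

lemma auxK_trace {X Y : Type*} [DecidableEq X] [Fintype X] [Fintype Y] (M : Matrix Y Y ℂ)
    (ρ : Matrix (X × Y) (X × Y) ℂ) :
    (auxK M * ρ).trace = (M * bptFst ρ).trace := by
  simp only [auxK, Matrix.trace, Matrix.diag,
    Matrix.mul_apply, Fintype.sum_prod_type, bptFst, Finset.mul_sum]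
  rw [Finset.sum_comm]
  refine Finset.sum_congr rfl fun b _ => ?_
  conv_rhs => rw [Finset.sum_comm]
  refine Finset.sum_congr rfl fun a' _ => ?_
  rw [Finset.sum_comm]
  refine Finset.sum_congr rfl fun b' _ => ?_
  simp

lemma ptC_K (ρ : Matrix (A × B × C) (A × B × C) ℂ) :
    ptC (auxK (ptA ρ) : Matrix (A × B × C) _ ℂ) = auxK (ptAC ρ) := by
  ext x y
  simp only [ptC, auxK, ptA, ptAC]
  rw [Finset.sum_comm, Finset.mul_sum]

lemma bpt_ptC (ρ : Matrix (A × B × C) (A × B × C) ℂ) : bptFst (ptC ρ) = ptAC ρ := rfl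

lemma bpt_eq (ρ : Matrix (A × B × C) (A × B × C) ℂ) : bptFst ρ = ptA ρ := rfl

lemma aux_posC [Nonempty C] {ρ : Matrix (A × B × C) (A × B × C) ℂ} (h : ρ.PosDef) :
    (ptC ρ).PosDef := by
  have : ptC ρ = ∑ c : C, ρ.submatrix (fun x : A × B => (x.1, x.2, c)) (fun x => (x.1, x.2, c)) := by
    ext x y
    simp [ptC, Matrix.sum_apply]
  rw [this]
  refine Matrix.posDef_sum Finset.univ_nonempty fun c _ => h.submatrix ?_
  intro x y hxy
  simpa [Prod.ext_iff] using hxy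

lemma aux_posK {X Y : Type*} [Fintype X] [Fintype Y] [Nonempty X]
    {ρ : Matrix (X × Y) (X × Y) ℂ} (h : ρ.PosDef) :
    (bptFst ρ).PosDef := by
  have : bptFst ρ = ∑ c : X, ρ.submatrix (fun x : Y => (c, x)) (fun x => (c, x)) := by
    ext x y
    simp [bptFst, Matrix.sum_apply]
  rw [this]
  refine Matrix.posDef_sum Finset.univ_nonempty fun c _ => h.submatrix ?_
  intro x y hxy
  simpa [Prod.ext_iff] using hxy

end auxTri

/-- The Petz recovery map applied to `ρ_AB` exactly recovers an invertible
quantum Markov chain: `ρ_ABC = ρ_BC^{1/2} ρ_B^{-1/2} ρ_AB ρ_B^{-1/2} ρ_BC^{1/2}`, with each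
factor extended to the tripartite space by tensoring with identities. -/
theorem qmc_petz_recovery {A B C : Type*} [Fintype A] [Fintype B] [Fintype C]
    [DecidableEq A] [DecidableEq B] [DecidableEq C]
    (ρ : Matrix (A × B × C) (A × B × C) ℂ) (hρ : IsDensity ρ) (hρinv : IsUnit ρ)
    (hqmc : qcmi ρ = 0) :
    ρ = extBC (matSqrt (ptA ρ)) * extB (matInvSqrt (ptAC ρ)) * extAB (ptC ρ)
        * extB (matInvSqrt (ptAC ρ)) * extBC (matSqrt (ptA ρ)) := by
  have hpd : ρ.PosDef := hρ.1.posDef_iff_isUnit.2 hρinv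
  have hne : Nonempty (A × B × C) := by
    by_contra hcon
    rw [not_nonempty_iff] at hcon
    have := hρ.2
    simp [Matrix.trace] at this
  obtain ⟨a, b, c⟩ := hne
  haveI : Nonempty A := ⟨a⟩
  haveI : Nonempty C := ⟨c⟩
  have pAB : (ptC ρ).PosDef := aux_posC hpd
  have pBC : (ptA ρ).PosDef := aux_posK hpd
  have pB : (ptAC ρ).PosDef := aux_posK pAB
  have h := hpd.1
  have hAB := pAB.1
  have hBC := pBC.1
  have hB := pB.1
  have sp := aux_spec h
  have spAB := aux_spec hAB
  have spBC := aux_spec hBC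
  have spB := aux_spec hB
  have u := aux_unit h
  have uAB := aux_unit hAB
  have uBC := aux_unit hBC
  have uB := aux_unit hB
  have lBC := aux_trlog _ uBC (fun i => Real.log (hBC.eigenvalues i)) hBC.eigenvalues
  have lB := aux_trlog _ uB (fun i => Real.log (hB.eigenvalues i)) hB.eigenvalues
  rw [← spBC] at lBC
  rw [← spB] at lB
  have hq : ((qcmi ρ : ℝ) : ℂ) = 0 := by rw [hqmc]; simp
  rw [qcmi] at hq
  push_cast at hq
  rw [aux_vn h, aux_vn hAB, aux_vn hBC, aux_vn hB] at hq
  -- spectral data of the reference operators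
  have kBC : ∀ f : B × C → ℝ, (auxK (hBC.eigenvectorUnitary : Matrix (B × C) (B × C) ℂ) :
      Matrix (A × B × C) _ ℂ) * auxD (fun p => f p.2) *
      (auxK (hBC.eigenvectorUnitary : Matrix (B × C) (B × C) ℂ))ᴴ
      = auxK ((hBC.eigenvectorUnitary : Matrix (B × C) (B × C) ℂ) * auxD f *
        (hBC.eigenvectorUnitary : Matrix (B × C) (B × C) ℂ)ᴴ) := by
    intro f
    rw [auxK_mul, auxK_mul, auxK_star, auxK_D]
  have kB : ∀ f : B → ℝ, (auxK (hB.eigenvectorUnitary : Matrix B B ℂ) :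
      Matrix (A × B) _ ℂ) * auxD (fun p => f p.2) *
      (auxK (hB.eigenvectorUnitary : Matrix B B ℂ))ᴴ
      = auxK ((hB.eigenvectorUnitary : Matrix B B ℂ) * auxD f *
        (hB.eigenvectorUnitary : Matrix B B ℂ)ᴴ) := by
    intro f
    rw [auxK_mul, auxK_mul, auxK_star, auxK_D]
  have main := aux_mid (auxE : Matrix (A × B) (A × B) ℂ →ₗ[ℂ] Matrix (A × B × C) (A × B × C) ℂ)
    auxE_mul auxE_star auxE_one
    (h.eigenvectorUnitary : Matrix (A × B × C) (A × B × C) ℂ)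
    (auxK (hBC.eigenvectorUnitary : Matrix (B × C) (B × C) ℂ))
    (hAB.eigenvectorUnitary : Matrix (A × B) (A × B) ℂ)
    (auxK (hB.eigenvectorUnitary : Matrix B B ℂ))
    h.eigenvalues (fun p => hBC.eigenvalues p.2) hAB.eigenvalues (fun p => hB.eigenvalues p.2)
    u (by rw [← auxK_star, ← auxK_mul, uBC, auxK_one])
    uAB (by rw [← auxK_star, ← auxK_mul, uB, auxK_one])
    hpd.eigenvalues_pos (fun p => pBC.eigenvalues_pos p.2)
    pAB.eigenvalues_pos (fun p => pB.eigenvalues_pos p.2)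
    (by
      intro X
      rw [← sp, ← spAB, auxE_trace])
    (by
      intro X
      rw [kBC hBC.eigenvalues, kB hB.eigenvalues, ← spBC, ← spB, auxE_trace, ptC_K])
    (by
      rw [kBC (fun i => Real.log (hBC.eigenvalues i)), kB (fun i => Real.log (hB.eigenvalues i)),
        ← sp, ← spAB, auxK_trace, auxK_trace, bpt_eq, bpt_ptC, lBC, lB]
      linear_combination -hq)
  rw [kBC (fun i => √(hBC.eigenvalues i)), kB (fun i => √(hB.eigenvalues i))] at main
  have qw := aux_fsq _ u _ hpd.eigenvalues_pos
  have stw := aux_fstar (h.eigenvectorUnitary : Matrix (A × B × C) (A × B × C) ℂ)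
    (fun i => √(h.eigenvalues i))
  have qAB := aux_fsq _ uAB _ pAB.eigenvalues_pos
  have stAB := aux_fstar (hAB.eigenvectorUnitary : Matrix (A × B) (A × B) ℂ)
    (fun i => √(hAB.eigenvalues i))
  have oAB := aux_fone _ uAB (fun i => √(hAB.eigenvalues i)) (fun i => (√(hAB.eigenvalues i))⁻¹)
    (fun i => mul_inv_cancel₀ (Real.sqrt_pos.2 (pAB.eigenvalues_pos i)).ne')
  have oB := aux_fone _ uB (fun i => (√(hB.eigenvalues i))⁻¹) (fun i => √(hB.eigenvalues i))
    (fun i => inv_mul_cancel₀ (Real.sqrt_pos.2 (pB.eigenvalues_pos i)).ne')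
  have stB := aux_fstar (hB.eigenvectorUnitary : Matrix B B ℂ) (fun i => (√(hB.eigenvalues i))⁻¹)
  have stBC := aux_fstar (hBC.eigenvectorUnitary : Matrix (B × C) (B × C) ℂ)
    (fun i => √(hBC.eigenvalues i))
  rw [← sp] at qw
  rw [← spAB] at qAB
  rw [extBC_eq, extB_eq, matSqrt, matInvSqrt, aux_matFun _ hBC, aux_matFun _ hB]
  change ρ = _ * _ * auxE (ptC ρ) * _ * _
  -- names for the square roots
  generalize (h.eigenvectorUnitary : Matrix (A × B × C) (A × B × C) ℂ) *
    auxD (fun i => √(h.eigenvalues i)) *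
    (h.eigenvectorUnitary : Matrix (A × B × C) (A × B × C) ℂ)ᴴ = w at *
  generalize (hAB.eigenvectorUnitary : Matrix (A × B) (A × B) ℂ) *
    auxD (fun i => √(hAB.eigenvalues i)) *
    (hAB.eigenvectorUnitary : Matrix (A × B) (A × B) ℂ)ᴴ = a1 at *
  generalize (hAB.eigenvectorUnitary : Matrix (A × B) (A × B) ℂ) *
    auxD (fun i => (√(hAB.eigenvalues i))⁻¹) *
    (hAB.eigenvectorUnitary : Matrix (A × B) (A × B) ℂ)ᴴ = a2 at *
  generalize (hB.eigenvectorUnitary : Matrix B B ℂ) * auxD (fun i => √(hB.eigenvalues i)) *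
    (hB.eigenvectorUnitary : Matrix B B ℂ)ᴴ = b1 at *
  generalize (hB.eigenvectorUnitary : Matrix B B ℂ) * auxD (fun i => (√(hB.eigenvalues i))⁻¹) *
    (hB.eigenvectorUnitary : Matrix B B ℂ)ᴴ = b2 at *
  generalize (hBC.eigenvectorUnitary : Matrix (B × C) (B × C) ℂ) *
    auxD (fun i => √(hBC.eigenvalues i)) *
    (hBC.eigenvectorUnitary : Matrix (B × C) (B × C) ℂ)ᴴ = s1 at *
  have hw : w = auxE (a1 * auxK b2) * auxK s1 := by
    have e : a1 * auxK b2 * (auxK b1 * a2) = 1 := by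
      have : a1 * auxK b2 * (auxK b1 * a2) = a1 * ((auxK b2 * auxK b1) * a2) := by
        simp only [mul_assoc]
      rw [this, ← auxK_mul, oB, auxK_one, one_mul, oAB]
    rw [main, ← mul_assoc, ← auxE_mul, e, auxE_one, one_mul]
  calc ρ = wᴴ * w := by rw [stw, qw]
    _ = (auxE (a1 * auxK b2) * auxK s1)ᴴ * (auxE (a1 * auxK b2) * auxK s1) := by rw [← hw]
    _ = _ := by
      rw [Matrix.conjTranspose_mul, ← auxE_star, Matrix.conjTranspose_mul, ← auxK_star,
        ← auxK_star, stB, stAB, stBC, ← qAB]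
      simp only [auxE_mul, mul_assoc]
end

section
/- Let ρ_AB be a density operator on H_A⊗H_B and ρ_BC a density operator on H_B⊗H_C such that ρ_B := Tr_A(ρ_AB) = Tr_C(ρ_BC) is invertible. If the operator Θ_ABC := ρ_BC^{1/2} ρ_B^{−1/2} ρ_AB^{1/2} (each factor extended to H_A⊗H_B⊗H_C by tensoring with identities) is normal, then ϱ_ABC := Θ_ABC Θ_ABC† is a density operator on H_A⊗H_B⊗H_C satisfying Tr_A(ϱ_ABC) = ρ_BC, Tr_C(ϱ_ABC) = ρ_AB, and I_{ϱ_ABC}(A:C|B) = 0; hence {ρ_AB, ρ_BC} is compatible with a quantum Markov chain in order A−B−C. -/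
open scoped Matrix ComplexOrder

variable {A B C : Type*}

section Helpers
set_option linter.unusedSectionVars false
open scoped Kronecker
open Matrix

lemma sum_interp {ι κ : Type*} [Fintype ι] [Fintype κ] (a : ι → ℂ) (x : ι → ℝ)
    (c : κ → ℂ) (y : κ → ℝ)
    (h : ∀ n : ℕ, ∑ i, a i * ((x i : ℝ) : ℂ) ^ n = ∑ t, c t * ((y t : ℝ) : ℂ) ^ n)
    (φ : ℝ → ℝ) :
    ∑ i, a i * ((φ (x i) : ℝ) : ℂ) = ∑ t, c t * ((φ (y t) : ℝ) : ℂ) := by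
  classical
  let s : Finset ℝ := Finset.univ.image x ∪ Finset.univ.image y
  let p : Polynomial ℝ := Lagrange.interpolate s id φ
  have hp : ∀ z ∈ s, p.eval z = φ z := fun z hz =>
    Lagrange.eval_interpolate_at_node φ (v := id) (Function.injective_id.injOn) hz
  have hx : ∀ i, φ (x i) = p.eval (x i) := fun i => (hp _ (by simp [s])).symm
  have hy : ∀ i, φ (y i) = p.eval (y i) := fun i => (hp _ (by simp [s])).symm
  simp only [hx, hy, Polynomial.eval_eq_sum_range]
  push_cast
  simp only [Finset.mul_sum]
  rw [Finset.sum_comm]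
  conv_rhs => rw [Finset.sum_comm]
  refine Finset.sum_congr rfl fun n _ => ?_
  have := congrArg (fun z => (p.coeff n : ℂ) * z) (h n)
  simp only [Finset.mul_sum] at this
  convert this using 2 <;> ring

section MF
variable {n : Type*} [Fintype n] [DecidableEq n] {ρ : Matrix n n ℂ}

lemma matFun_mul (h : ρ.IsHermitian) (f g : ℝ → ℝ) :
    matFun f ρ * matFun g ρ = matFun (fun x => f x * g x) ρ := by
  simp only [matFun, dif_pos h]
  have hU : star (h.eigenvectorUnitary : Matrix n n ℂ) * (h.eigenvectorUnitary : Matrix n n ℂ) = 1 :=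
    Unitary.coe_star_mul_self _
  simp only [Matrix.mul_assoc]
  rw [← Matrix.mul_assoc (star _) (h.eigenvectorUnitary : Matrix n n ℂ), hU, Matrix.one_mul,
    ← Matrix.mul_assoc (diagonal _) (diagonal _), diagonal_mul_diagonal]
  simp

lemma matFun_congr (h : ρ.IsHermitian) {f g : ℝ → ℝ}
    (hfg : ∀ i, f (h.eigenvalues i) = g (h.eigenvalues i)) : matFun f ρ = matFun g ρ := by
  simp only [matFun, dif_pos h, hfg]

lemma matFun_id (h : ρ.IsHermitian) : matFun (fun x => x) ρ = ρ := by
  simp only [matFun, dif_pos h]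
  conv_rhs => rw [h.spectral_theorem]
  simp [Unitary.conjStarAlgAut_apply, Function.comp_def]

lemma matFun_one (h : ρ.IsHermitian) : matFun (fun _ => 1) ρ = 1 := by
  simp [matFun, dif_pos h]

lemma matFun_pow (h : ρ.IsHermitian) (f : ℝ → ℝ) (k : ℕ) :
    matFun (fun x => f x ^ k) ρ = matFun f ρ ^ k := by
  induction k with
  | zero => simpa using matFun_one h
  | succ k ih => rw [pow_succ, ← ih, matFun_mul h]; simp only [pow_succ]

lemma matFun_star (f : ℝ → ℝ) : (matFun f ρ)ᴴ = matFun f ρ := by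
  by_cases h : ρ.IsHermitian
  · simp only [matFun, dif_pos h, conjTranspose_mul, star_eq_conjTranspose,
      conjTranspose_conjTranspose, diagonal_conjTranspose, Matrix.mul_assoc]
    congr 3
    funext i; simp
  · simp [matFun, dif_neg h]

lemma trace_matFun (h : ρ.IsHermitian) (f : ℝ → ℝ) :
    (matFun f ρ).trace = ∑ i, ((f (h.eigenvalues i) : ℝ) : ℂ) := by
  have hU : star (h.eigenvectorUnitary : Matrix n n ℂ) * (h.eigenvectorUnitary : Matrix n n ℂ) = 1 :=
    Unitary.coe_star_mul_self _
  simp only [matFun, dif_pos h]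
  rw [Matrix.trace_mul_comm, ← Matrix.mul_assoc, hU, Matrix.one_mul, trace_diagonal]

/-- rank one spectral pieces -/
noncomputable def specP (h : ρ.IsHermitian) (i : n) : Matrix n n ℂ :=
  (h.eigenvectorUnitary : Matrix n n ℂ) * Matrix.single i i 1 *
    star (h.eigenvectorUnitary : Matrix n n ℂ)

lemma matFun_eq_sum (h : ρ.IsHermitian) (f : ℝ → ℝ) :
    matFun f ρ = ∑ i, ((f (h.eigenvalues i) : ℝ) : ℂ) • specP h i := by
  simp only [matFun, dif_pos h, specP]
  rw [← Matrix.sum_single_eq_diagonal, Finset.mul_sum, Finset.sum_mul]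
  refine Finset.sum_congr rfl fun i _ => ?_
  rw [← Matrix.smul_mul, ← Matrix.mul_smul]
  simp

lemma vnEntropy_eq (h : ρ.IsHermitian) :
    (vnEntropy ρ : ℂ) = -(matFun (fun x => x * Real.log x) ρ).trace := by
  rw [trace_matFun h]
  simp [vnEntropy, dif_pos h]

end MF

section Ext
variable {A B C : Type*} [Fintype A] [Fintype B] [Fintype C]
    [DecidableEq A] [DecidableEq B] [DecidableEq C]

lemma extAB_mul (M N : Matrix (A × B) (A × B) ℂ) :
    (extAB (M * N) : Matrix (A × B × C) (A × B × C) ℂ) = extAB M * extAB N := by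
  ext ⟨a, b, c⟩ ⟨a', b', c'⟩
  simp [extAB, Matrix.mul_apply, Fintype.sum_prod_type]

lemma extBC_mul (M N : Matrix (B × C) (B × C) ℂ) :
    (extBC (M * N) : Matrix (A × B × C) (A × B × C) ℂ) = extBC M * extBC N := by
  ext ⟨a, b, c⟩ ⟨a', b', c'⟩
  simp [extBC, Matrix.mul_apply, Fintype.sum_prod_type, Finset.mul_sum]

lemma extB_eq_BC (M : Matrix B B ℂ) :
    (extB M : Matrix (A × B × C) (A × B × C) ℂ) = extBC (M ⊗ₖ (1 : Matrix C C ℂ)) := by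
  ext ⟨a, b, c⟩ ⟨a', b', c'⟩
  simp [extBC, extB, Matrix.one_apply]

lemma extB_eq_AB (M : Matrix B B ℂ) :
    (extB M : Matrix (A × B × C) (A × B × C) ℂ) = extAB ((1 : Matrix A A ℂ) ⊗ₖ M) := by
  ext ⟨a, b, c⟩ ⟨a', b', c'⟩
  simp [extAB, extB, Matrix.one_apply]

lemma extAB_star (M : Matrix (A × B) (A × B) ℂ) :
    (extAB M : Matrix (A × B × C) (A × B × C) ℂ)ᴴ = extAB Mᴴ := by
  ext ⟨a, b, c⟩ ⟨a', b', c'⟩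
  simp only [extAB, conjTranspose_apply, eq_comm (a := c)]
  split_ifs <;> simp

lemma extBC_star (M : Matrix (B × C) (B × C) ℂ) :
    (extBC M : Matrix (A × B × C) (A × B × C) ℂ)ᴴ = extBC Mᴴ := by
  ext ⟨a, b, c⟩ ⟨a', b', c'⟩
  simp only [extBC, conjTranspose_apply, eq_comm (a := a)]
  split_ifs <;> simp

lemma extBC_one : (extBC (1 : Matrix (B × C) (B × C) ℂ) : Matrix (A × B × C) (A × B × C) ℂ) = 1 := by
  ext ⟨a, b, c⟩ ⟨a', b', c'⟩
  simp [extBC, Matrix.one_apply, Prod.mk.injEq]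
  aesop

lemma extAB_one : (extAB (1 : Matrix (A × B) (A × B) ℂ) : Matrix (A × B × C) (A × B × C) ℂ) = 1 := by
  ext ⟨a, b, c⟩ ⟨a', b', c'⟩
  simp [extAB, Matrix.one_apply, Prod.mk.injEq]
  aesop

lemma ptA_left (u : Matrix (B × C) (B × C) ℂ) (M : Matrix (A × B × C) (A × B × C) ℂ) :
    ptA (extBC u * M) = u * ptA M := by
  ext ⟨b, c⟩ ⟨b', c'⟩
  simp only [ptA, extBC, Matrix.mul_apply, Fintype.sum_prod_type (α₁ := A), Finset.mul_sum]
  rw [Finset.sum_comm (s := (Finset.univ : Finset (B × C)))]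
  refine Finset.sum_congr rfl fun a _ => ?_
  rw [Finset.sum_eq_single a] <;> simp +contextual [eq_comm]

lemma ptA_right (u : Matrix (B × C) (B × C) ℂ) (M : Matrix (A × B × C) (A × B × C) ℂ) :
    ptA (M * extBC u) = ptA M * u := by
  ext ⟨b, c⟩ ⟨b', c'⟩
  simp only [ptA, extBC, Matrix.mul_apply, Fintype.sum_prod_type (α₁ := A), Finset.sum_mul]
  rw [Finset.sum_comm (s := (Finset.univ : Finset (B × C)))]
  refine Finset.sum_congr rfl fun a _ => ?_
  rw [Finset.sum_eq_single a] <;> simp +contextual [eq_comm]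

lemma ptC_left (u : Matrix (A × B) (A × B) ℂ) (M : Matrix (A × B × C) (A × B × C) ℂ) :
    ptC (extAB u * M) = u * ptC M := by
  ext ⟨a, b⟩ ⟨a', b'⟩
  simp only [ptC, extAB, Matrix.mul_apply, Fintype.sum_prod_type, Finset.mul_sum]
  rw [Finset.sum_comm]
  refine Finset.sum_congr rfl fun a _ => ?_
  rw [Finset.sum_comm]
  refine Finset.sum_congr rfl fun b _ => ?_
  refine Finset.sum_congr rfl fun c _ => ?_
  simp

lemma ptC_right (u : Matrix (A × B) (A × B) ℂ) (M : Matrix (A × B × C) (A × B × C) ℂ) :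
    ptC (M * extAB u) = ptC M * u := by
  ext ⟨a, b⟩ ⟨a', b'⟩
  simp only [ptC, extAB, Matrix.mul_apply, Fintype.sum_prod_type, Finset.sum_mul]
  rw [Finset.sum_comm]
  refine Finset.sum_congr rfl fun a _ => ?_
  rw [Finset.sum_comm]
  refine Finset.sum_congr rfl fun b _ => ?_
  refine Finset.sum_congr rfl fun c _ => ?_
  simp

lemma ptA_extAB (M : Matrix (A × B) (A × B) ℂ) :
    ptA (extAB M : Matrix (A × B × C) (A × B × C) ℂ) = bptFst M ⊗ₖ (1 : Matrix C C ℂ) := by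
  ext ⟨b, c⟩ ⟨b', c'⟩
  simp [ptA, extAB, bptFst, Matrix.one_apply]

lemma ptC_extBC (M : Matrix (B × C) (B × C) ℂ) :
    ptC (extBC M : Matrix (A × B × C) (A × B × C) ℂ) = (1 : Matrix A A ℂ) ⊗ₖ bptSnd M := by
  ext ⟨a, b⟩ ⟨a', b'⟩
  simp [ptC, extBC, bptSnd, Matrix.one_apply, Finset.mul_sum]

lemma trace_ptA (M : Matrix (A × B × C) (A × B × C) ℂ) : (ptA M).trace = M.trace := by
  simp only [Matrix.trace, ptA, Matrix.diag, Fintype.sum_prod_type (α₁ := A)]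
  rw [Finset.sum_comm]

lemma trace_ptC (M : Matrix (A × B × C) (A × B × C) ℂ) : (ptC M).trace = M.trace := by
  simp only [Matrix.trace, ptC, Matrix.diag, Fintype.sum_prod_type]

lemma ptAC_eq (M : Matrix (A × B × C) (A × B × C) ℂ) : ptAC M = bptFst (ptC M) := rfl

lemma trace_bptFst_mul (M : Matrix (A × B) (A × B) ℂ) (y : Matrix B B ℂ) :
    (M * ((1 : Matrix A A ℂ) ⊗ₖ y)).trace = (bptFst M * y).trace := by
  simp only [Matrix.trace, Matrix.diag, Matrix.mul_apply, Fintype.sum_prod_type, bptFst,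
    kroneckerMap_apply, Matrix.one_apply, Finset.sum_mul]
  rw [Finset.sum_comm]
  refine Finset.sum_congr rfl fun b _ => ?_
  conv_rhs => rw [Finset.sum_comm]
  refine Finset.sum_congr rfl fun a _ => ?_
  rw [Finset.sum_eq_single a] <;> simp +contextual

lemma bptFst_psd {M : Matrix (A × B) (A × B) ℂ} (h : M.PosSemidef) : (bptFst M).PosSemidef := by
  have : bptFst M = ∑ a : A, M.submatrix (fun b => (a, b)) (fun b => (a, b)) := by
    ext b b'; simp [bptFst, Matrix.sum_apply]
  rw [this]
  exact Matrix.posSemidef_sum _ fun a _ => h.submatrix _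


lemma ptA_star (M : Matrix (A × B × C) (A × B × C) ℂ) : ptA Mᴴ = (ptA M)ᴴ := by
  ext x y
  simp [ptA, conjTranspose_apply]

lemma extAB_sum {ι : Type*} [Fintype ι] (s : ι → ℂ) (M : ι → Matrix (A × B) (A × B) ℂ) :
    (extAB (∑ i, s i • M i) : Matrix (A × B × C) (A × B × C) ℂ) = ∑ i, s i • extAB (M i) := by
  ext x y
  simp only [extAB, Matrix.sum_apply, Matrix.smul_apply, smul_eq_mul, Finset.sum_mul, mul_assoc]

lemma extBC_sum {ι : Type*} [Fintype ι] (s : ι → ℂ) (M : ι → Matrix (B × C) (B × C) ℂ) :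
    (extBC (∑ i, s i • M i) : Matrix (A × B × C) (A × B × C) ℂ) = ∑ i, s i • extBC (M i) := by
  ext x y
  simp only [extBC, Matrix.sum_apply, Matrix.smul_apply, smul_eq_mul, Finset.mul_sum,
    mul_left_comm]

lemma extB_sum {ι : Type*} [Fintype ι] (s : ι → ℂ) (M : ι → Matrix B B ℂ) :
    (extB (∑ i, s i • M i) : Matrix (A × B × C) (A × B × C) ℂ) = ∑ i, s i • extB (M i) := by
  ext x y
  simp only [extB, Matrix.sum_apply, Matrix.smul_apply, smul_eq_mul, Finset.mul_sum,
    Finset.sum_mul]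
  refine Finset.sum_congr rfl fun i _ => ?_
  ring

/-- Fixed points of the transfer map intertwine `Z`. -/
lemma fix_intertwine (Z : Matrix (A × B × C) (A × B × C) ℂ) (hZ : Zᴴ = Z)
    (d y : Matrix (B × C) (B × C) ℂ) (hd : dᴴ = d) (hy : yᴴ = y) (hdy : d * y = 1)
    (hyd : y * d = 1) (hZZ : ptA (Z * Z) = d * d)
    (b : Matrix (B × C) (B × C) ℂ) (hb : ptA (Z * extBC b * Z) = d * b * d) :
    extBC b * Z = Z * extBC (y * b * d) := by
  have hb' : ptA (Z * extBC bᴴ * Z) = d * bᴴ * d := by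
    have := congrArg conjTranspose hb
    rw [← ptA_star] at this
    simpa [conjTranspose_mul, hZ, hd, extBC_star, Matrix.mul_assoc] using this
  rw [← sub_eq_zero, ← trace_conjTranspose_mul_self_eq_zero_iff]
  have t1 : (Z * extBC bᴴ * (extBC b * Z)).trace = (d * bᴴ * b * d).trace := by
    have : Z * extBC bᴴ * (extBC b * Z) = Z * (extBC (bᴴ * b) * Z) := by
      rw [extBC_mul]; simp only [Matrix.mul_assoc]
    rw [this, trace_mul_comm, Matrix.mul_assoc, ← trace_ptA, ptA_left, hZZ, ← Matrix.mul_assoc,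
      trace_mul_comm]
    simp only [Matrix.mul_assoc]
  have t2 : (Z * extBC bᴴ * (Z * extBC (y * b * d))).trace = (d * bᴴ * b * d).trace := by
    rw [← Matrix.mul_assoc, ← trace_ptA, ptA_right, hb']
    have : d * bᴴ * d * (y * b * d) = d * bᴴ * (d * y) * b * d := by
      simp only [Matrix.mul_assoc]
    rw [this, hdy, Matrix.mul_one]
  have t3 : (extBC (d * bᴴ * y) * Z * (extBC b * Z)).trace = (d * bᴴ * b * d).trace := by
    rw [Matrix.mul_assoc, ← trace_ptA, ptA_left, ← Matrix.mul_assoc Z, hb]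
    have : d * bᴴ * y * (d * b * d) = d * bᴴ * (y * d) * b * d := by
      simp only [Matrix.mul_assoc]
    rw [this, hyd, Matrix.mul_one]
  have t4 : (extBC (d * bᴴ * y) * Z * (Z * extBC (y * b * d))).trace
      = (d * bᴴ * b * d).trace := by
    rw [Matrix.mul_assoc, ← Matrix.mul_assoc Z, ← trace_ptA, ptA_left, ptA_right, hZZ]
    have : d * bᴴ * y * (d * d * (y * b * d)) = d * bᴴ * (y * d) * (d * y) * b * d := by
      simp only [Matrix.mul_assoc]
    rw [this, hyd, hdy, Matrix.mul_one, Matrix.mul_one]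
  have e1 : (extBC b * Z - Z * extBC (y * b * d))ᴴ = Z * extBC bᴴ - extBC (d * bᴴ * y) * Z := by
    simp [conjTranspose_sub, conjTranspose_mul, hZ, hd, hy, extBC_star, Matrix.mul_assoc]
  rw [e1, Matrix.sub_mul, Matrix.mul_sub, Matrix.mul_sub, trace_sub, trace_sub, trace_sub,
    t1, t2, t3, t4]
  simp

lemma power_formula (Z : Matrix (A × B × C) (A × B × C) ℂ) (hZ : Zᴴ = Z)
    (d y : Matrix (B × C) (B × C) ℂ) (hd : dᴴ = d) (hy : yᴴ = y) (hdy : d * y = 1)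
    (hyd : y * d = 1) (hZZ : ptA (Z * Z) = d * d)
    (w : Matrix (B × C) (B × C) ℂ) (hw : ptA (Z * extBC (y * w * y) * Z) = w) (n : ℕ) :
    (Z * extBC (y * w * y) * Z) ^ n = (Z * Z) ^ n * extBC ((y * y) ^ n * w ^ n) := by
  have key := fix_intertwine Z hZ d y hd hy hdy hyd hZZ
  have hyda : ∀ u, y * (d * u) = u := fun u => by rw [← Matrix.mul_assoc, hyd, Matrix.one_mul]
  have hdya : ∀ u, d * (y * u) = u := fun u => by rw [← Matrix.mul_assoc, hdy, Matrix.one_mul]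
  have shift : ∀ b, extBC b * Z = Z * extBC (y * b * d) →
      extBC (y * b * d) * Z = Z * extBC (y * (y * b * d) * d) := by
    intro b hb
    apply key
    rw [← hb, Matrix.mul_assoc, ptA_left, hZZ]
    simp only [Matrix.mul_assoc, hdya]
  have hmul : ∀ b c, extBC b * Z = Z * extBC (y * b * d) → extBC c * Z = Z * extBC (y * c * d) →
      extBC (b * c) * Z = Z * extBC (y * (b * c) * d) := by
    intro b c hb hc
    rw [extBC_mul, Matrix.mul_assoc, hc, ← Matrix.mul_assoc, hb, Matrix.mul_assoc, ← extBC_mul]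
    simp only [Matrix.mul_assoc, hdya]
  have hL : extBC (y * w * y) * Z = Z * extBC (y * (y * w * y) * d) := by
    apply key
    rw [hw]
    simp only [Matrix.mul_assoc, hdya, hyd, Matrix.mul_one]
  have hL1 := shift _ hL
  have eL : y * (y * w * y) * d = y * y * w := by
    simp only [Matrix.mul_assoc, hyd, Matrix.mul_one]
  rw [eL] at hL hL1
  have hρ : Z * extBC (y * w * y) * Z = (Z * Z) * extBC (y * y * w) := by
    rw [Matrix.mul_assoc Z, hL, ← Matrix.mul_assoc Z Z]
  rw [hρ]
  have main : extBC ((y * y) ^ n * w ^ n) * Z = Z * extBC (y * ((y * y) ^ n * w ^ n) * d) ∧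
      ((Z * Z) * extBC (y * y * w)) ^ n = (Z * Z) ^ n * extBC ((y * y) ^ n * w ^ n) := by
    induction n with
    | zero => simp [hyd, extBC_one]
    | succ n ih =>
      obtain ⟨ih1, ih2⟩ := ih
      set M := (y * y) ^ n * w ^ n with hM
      have s1 := shift _ ih1
      have s2 := shift _ s1
      have e : (y * y) ^ (n + 1) * w ^ (n + 1) = y * (y * M * d) * d * (y * y * w) := by
        rw [pow_succ', pow_succ, hM]
        simp only [Matrix.mul_assoc, hdya]
      rw [e]
      refine ⟨hmul _ _ s2 hL1, ?_⟩
      rw [pow_succ, ih2, pow_succ, extBC_mul (y * (y * M * d) * d)]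
      calc (Z * Z) ^ n * extBC M * (Z * Z * extBC (y * y * w))
          = (Z * Z) ^ n * (extBC M * Z) * Z * extBC (y * y * w) := by
            simp only [Matrix.mul_assoc]
        _ = (Z * Z) ^ n * Z * (extBC (y * M * d) * Z) * extBC (y * y * w) := by
            rw [ih1]; simp only [Matrix.mul_assoc]
        _ = _ := by rw [s1]; simp only [Matrix.mul_assoc]
  exact main.2

lemma tri_expand {ρ₁ : Matrix (A × B) (A × B) ℂ} {ρ₂ : Matrix B B ℂ}
    {ρ₃ : Matrix (B × C) (B × C) ℂ} (h₁ : ρ₁.IsHermitian) (h₂ : ρ₂.IsHermitian)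
    (h₃ : ρ₃.IsHermitian) (f g h : ℝ → ℝ) :
    ((extAB (matFun f ρ₁) : Matrix (A × B × C) (A × B × C) ℂ) * extB (matFun g ρ₂) *
      extBC (matFun h ρ₃)).trace =
    ∑ t : (A × B) × B × (B × C),
      ((extAB (specP h₁ t.1) : Matrix (A × B × C) (A × B × C) ℂ) * extB (specP h₂ t.2.1) *
      extBC (specP h₃ t.2.2)).trace *
      ((f (h₁.eigenvalues t.1) * g (h₂.eigenvalues t.2.1) * h (h₃.eigenvalues t.2.2) : ℝ) : ℂ) := by
  rw [matFun_eq_sum h₁, matFun_eq_sum h₂, matFun_eq_sum h₃, extAB_sum, extB_sum, extBC_sum]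
  conv_rhs => rw [Fintype.sum_prod_type]
  simp only [Finset.sum_mul, Matrix.trace_sum]
  refine Finset.sum_congr rfl fun i _ => ?_
  conv_rhs => rw [Fintype.sum_prod_type]
  simp only [Finset.mul_sum, Finset.sum_mul, Matrix.trace_sum]
  rw [Finset.sum_comm]
  refine Finset.sum_congr rfl fun j _ => ?_
  refine Finset.sum_congr rfl fun k _ => ?_
  simp only [Matrix.smul_mul, Matrix.mul_smul, trace_smul, smul_eq_mul]
  push_cast
  ring

lemma extAB_pow (M : Matrix (A × B) (A × B) ℂ) (n : ℕ) :
    (extAB M : Matrix (A × B × C) (A × B × C) ℂ) ^ n = extAB (M ^ n) := by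
  induction n with
  | zero => simp [extAB_one]
  | succ n ih => rw [pow_succ, pow_succ, extAB_mul, ih]

lemma kron_mul_one (M N : Matrix B B ℂ) :
    (M * N) ⊗ₖ (1 : Matrix C C ℂ) = (M ⊗ₖ (1 : Matrix C C ℂ)) * (N ⊗ₖ (1 : Matrix C C ℂ)) := by
  rw [← mul_kronecker_mul, Matrix.one_mul]

lemma kron_one_mul (M N : Matrix B B ℂ) :
    (1 : Matrix A A ℂ) ⊗ₖ (M * N) = ((1 : Matrix A A ℂ) ⊗ₖ M) * ((1 : Matrix A A ℂ) ⊗ₖ N) := by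
  rw [← mul_kronecker_mul, Matrix.one_mul]

lemma kron_pow_one (M : Matrix B B ℂ) (n : ℕ) :
    (M ⊗ₖ (1 : Matrix C C ℂ)) ^ n = (M ^ n) ⊗ₖ (1 : Matrix C C ℂ) := by
  induction n with
  | zero => simp
  | succ n ih => rw [pow_succ, pow_succ, kron_mul_one, ih]

end Ext
end Helpers

/-- Sufficiency: if the marginals `ρ_AB`, `ρ_BC` agree on `B`, `ρ_B` is
invertible, and `Θ_ABC = ρ_BC^{1/2} ρ_B^{-1/2} ρ_AB^{1/2}` is normal, then
`ϱ_ABC = Θ_ABC Θ_ABC†` is a density operator with marginals `ρ_BC` and `ρ_AB` and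
`I(A:C|B) = 0`; hence the pair is compatible with a quantum Markov chain in order A−B−C. -/
theorem qmc_compat_sufficient {A B C : Type*} [Fintype A] [Fintype B] [Fintype C]
    [DecidableEq A] [DecidableEq B] [DecidableEq C]
    (ρAB : Matrix (A × B) (A × B) ℂ) (ρBC : Matrix (B × C) (B × C) ℂ)
    (hAB : IsDensity ρAB) (hBC : IsDensity ρBC)
    (hB : bptFst ρAB = bptSnd ρBC) (hBinv : IsUnit (bptFst ρAB))
    (Θ : Matrix (A × B × C) (A × B × C) ℂ)
    (hΘ : Θ = extBC (matSqrt ρBC) * extB (matInvSqrt (bptFst ρAB)) * extAB (matSqrt ρAB))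
    (hnormal : Θ * Θᴴ = Θᴴ * Θ) :
    IsDensity (Θ * Θᴴ) ∧ ptA (Θ * Θᴴ) = ρBC ∧ ptC (Θ * Θᴴ) = ρAB ∧ qcmi (Θ * Θᴴ) = 0 := by
  classical
  have h1 : ρAB.IsHermitian := hAB.1.isHermitian
  have h3 : ρBC.IsHermitian := hBC.1.isHermitian
  have hpsd : (bptFst ρAB).PosSemidef := bptFst_psd hAB.1
  have h2 : (bptFst ρAB).IsHermitian := hpsd.isHermitian
  have hpd : (bptFst ρAB).PosDef := hpsd.posDef_iff_isUnit.mpr hBinv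
  have n1 : ∀ i, 0 ≤ h1.eigenvalues i := hAB.1.eigenvalues_nonneg
  have n3 : ∀ i, 0 ≤ h3.eigenvalues i := hBC.1.eigenvalues_nonneg
  have n2 : ∀ i, 0 < h2.eigenvalues i := hpd.eigenvalues_pos
  have dsB : bptSnd ρBC = bptFst ρAB := hB.symm
  generalize hρB : bptFst ρAB = ρB at *
  have s1 : matSqrt ρAB * matSqrt ρAB = ρAB := by
    rw [matSqrt, matFun_mul h1]
    conv_rhs => rw [← matFun_id h1]
    exact matFun_congr h1 fun i => Real.mul_self_sqrt (n1 i)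
  have s3 : matSqrt ρBC * matSqrt ρBC = ρBC := by
    rw [matSqrt, matFun_mul h3]
    conv_rhs => rw [← matFun_id h3]
    exact matFun_congr h3 fun i => Real.mul_self_sqrt (n3 i)
  have s2 : matSqrt ρB * matSqrt ρB = ρB := by
    rw [matSqrt, matFun_mul h2]
    conv_rhs => rw [← matFun_id h2]
    exact matFun_congr h2 fun i => Real.mul_self_sqrt (n2 i).le
  have dy : matSqrt ρB * matInvSqrt ρB = 1 := by
    rw [matSqrt, matInvSqrt, matFun_mul h2, ← matFun_one h2]
    exact matFun_congr h2 fun i => mul_inv_cancel₀ (Real.sqrt_pos.mpr (n2 i)).ne'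
  have yd : matInvSqrt ρB * matSqrt ρB = 1 := by
    rw [matSqrt, matInvSqrt, matFun_mul h2, ← matFun_one h2]
    exact matFun_congr h2 fun i => inv_mul_cancel₀ (Real.sqrt_pos.mpr (n2 i)).ne'
  have yy : matInvSqrt ρB * matInvSqrt ρB = matFun (fun x => x⁻¹) ρB := by
    rw [matInvSqrt, matFun_mul h2]
    refine matFun_congr h2 fun i => ?_
    rw [← mul_inv, Real.mul_self_sqrt (n2 i).le]
  have yρy : matInvSqrt ρB * ρB * matInvSqrt ρB = 1 := by
    calc matInvSqrt ρB * ρB * matInvSqrt ρB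
        = (matInvSqrt ρB * matSqrt ρB) * (matSqrt ρB * matInvSqrt ρB) := by
          rw [Matrix.mul_assoc, Matrix.mul_assoc, ← Matrix.mul_assoc (matSqrt ρB), s2]
      _ = 1 := by rw [yd, dy, Matrix.one_mul]
  have a1 : (matSqrt ρAB)ᴴ = matSqrt ρAB := matFun_star _
  have a3 : (matSqrt ρBC)ᴴ = matSqrt ρBC := matFun_star _
  have a2 : (matInvSqrt ρB)ᴴ = matInvSqrt ρB := matFun_star _
  have a2' : (matSqrt ρB)ᴴ = matSqrt ρB := matFun_star _
  set Z : Matrix (A × B × C) (A × B × C) ℂ := extAB (matSqrt ρAB) with hZdef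
  set d : Matrix (B × C) (B × C) ℂ := Matrix.kroneckerMap (fun a b : ℂ => a * b) (matSqrt ρB) (1 : Matrix C C ℂ) with hd
  set y : Matrix (B × C) (B × C) ℂ := Matrix.kroneckerMap (fun a b : ℂ => a * b) (matInvSqrt ρB) (1 : Matrix C C ℂ) with hy
  have Zs : Zᴴ = Z := by rw [hZdef, extAB_star, a1]
  have ds : dᴴ = d := by
    rw [hd, Matrix.conjTranspose_kronecker, a2', Matrix.conjTranspose_one]
  have ys : yᴴ = y := by
    rw [hy, Matrix.conjTranspose_kronecker, a2, Matrix.conjTranspose_one]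
  have hdy : d * y = 1 := by
    rw [hd, hy, ← kron_mul_one, dy, Matrix.one_kronecker_one]
  have hyd : y * d = 1 := by
    rw [hd, hy, ← kron_mul_one, yd, Matrix.one_kronecker_one]
  have ZZ : Z * Z = extAB ρAB := by rw [hZdef, ← extAB_mul, s1]
  have hZZ : ptA (Z * Z) = d * d := by
    rw [ZZ, ptA_extAB, hρB, hd, ← kron_mul_one, s2]
  have eY : (extB (matInvSqrt ρB) : Matrix (A × B × C) (A × B × C) ℂ) = extBC y := extB_eq_BC _
  have Θ1 : Θ = extBC (matSqrt ρBC * y) * Z := by rw [hΘ, eY, extBC_mul]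
  have Θ1s : Θᴴ = Z * extBC (y * matSqrt ρBC) := by
    rw [Θ1, Matrix.conjTranspose_mul, extBC_star, Matrix.conjTranspose_mul, ys, a3, Zs]
  -- marginals
  have mA : ptA (Θ * Θᴴ) = ρBC := by
    rw [Θ1s, Θ1, Matrix.mul_assoc, ← Matrix.mul_assoc Z, ptA_left, ptA_right, hZZ]
    calc matSqrt ρBC * y * (d * d * (y * matSqrt ρBC))
        = matSqrt ρBC * (y * d) * (d * y) * matSqrt ρBC := by simp only [Matrix.mul_assoc]
      _ = ρBC := by rw [hyd, hdy, Matrix.mul_one, Matrix.mul_one, s3]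
  have ρform : Θ * Θᴴ = Z * extBC (y * ρBC * y) * Z := by
    rw [hnormal, Θ1s, Θ1]
    conv_rhs => rw [← s3]
    simp only [extBC_mul, Matrix.mul_assoc]
  have mC : ptC (Θ * Θᴴ) = ρAB := by
    have eYA : (extBC y : Matrix (A × B × C) (A × B × C) ℂ)
        = extAB (Matrix.kroneckerMap (fun a b : ℂ => a * b) (1 : Matrix A A ℂ) (matInvSqrt ρB)) := by
      rw [← eY]; exact extB_eq_AB _
    rw [ρform, ptC_right, ptC_left, extBC_mul, extBC_mul, eYA, ptC_right, ptC_left, ptC_extBC, dsB,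
      ← kron_one_mul, ← kron_one_mul, yρy, Matrix.one_kronecker_one, Matrix.mul_one, s1]
  have psd : (Θ * Θᴴ).PosSemidef := Matrix.posSemidef_self_mul_conjTranspose Θ
  refine ⟨⟨psd, by rw [← trace_ptA, mA]; exact hBC.2⟩, mA, mC, ?_⟩
  have h0 := psd.isHermitian
  have hpow : ∀ n : ℕ, (Θ * Θᴴ) ^ n = extAB (matFun (fun x => x ^ n) ρAB) *
      extB (matFun (fun x => x⁻¹ ^ n) ρB) * extBC (matFun (fun x => x ^ n) ρBC) := by
    intro n
    rw [matFun_pow h1 (fun x => x), matFun_pow h2 (fun x => x⁻¹), matFun_pow h3 (fun x => x),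
      matFun_id h1, matFun_id h3, extB_eq_BC, Matrix.mul_assoc, ← extBC_mul, ← extAB_pow, ← ZZ,
      ← yy, ← kron_pow_one, kron_mul_one, ρform]
    exact power_formula Z Zs d y ds ys hdy hyd hZZ ρBC (by rw [← ρform, mA]) n
  have interp := sum_interp (fun _ => 1) h0.eigenvalues
    (fun t : (A × B) × B × (B × C) =>
      ((extAB (specP h1 t.1) : Matrix (A × B × C) (A × B × C) ℂ) * extB (specP h2 t.2.1) *
      extBC (specP h3 t.2.2)).trace)
    (fun t => h1.eigenvalues t.1 * (h2.eigenvalues t.2.1)⁻¹ * h3.eigenvalues t.2.2)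
    (by
      intro n
      have e := congrArg Matrix.trace (hpow n)
      rw [tri_expand h1 h2 h3] at e
      have e2 : (Θ * Θᴴ) ^ n = matFun (fun x => x ^ n) (Θ * Θᴴ) := by
        rw [matFun_pow h0 (fun x => x), matFun_id h0]
      rw [e2, trace_matFun h0] at e
      simp only [one_mul]
      convert e using 2
      · push_cast; rfl
      · push_cast; ring)
    (fun x => x * Real.log x)
  have split : ∀ α β γ : ℝ, 0 ≤ α → 0 < β → 0 ≤ γ →
      (α * β⁻¹ * γ) * Real.log (α * β⁻¹ * γ) =
      α * Real.log α * β⁻¹ * γ - α * (β⁻¹ * Real.log β) * γ + α * β⁻¹ * (γ * Real.log γ) := by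
    intro α β γ hα hβ hγ
    rcases hα.eq_or_lt with rfl | hα
    · simp
    rcases hγ.eq_or_lt with rfl | hγ
    · simp
    rw [Real.log_mul (by positivity) hγ.ne', Real.log_mul hα.ne' (by positivity), Real.log_inv]
    ring
  simp only [one_mul] at interp
  rw [← trace_matFun h0 (fun x => x * Real.log x)] at interp
  have e3 := tri_expand (C := C) h1 h2 h3 (fun x => x * Real.log x) (fun x => x⁻¹) (fun x => x)
  have e4 := tri_expand (C := C) h1 h2 h3 (fun x => x) (fun x => x⁻¹ * Real.log x) (fun x => x)
  have e5 := tri_expand (C := C) h1 h2 h3 (fun x => x) (fun x => x⁻¹) (fun x => x * Real.log x)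
  have tot : (matFun (fun x => x * Real.log x) (Θ * Θᴴ)).trace =
      ((extAB (matFun (fun x => x * Real.log x) ρAB) : Matrix (A × B × C) (A × B × C) ℂ) *
        extB (matFun (fun x => x⁻¹) ρB) * extBC (matFun (fun x => x) ρBC)).trace
      - ((extAB (matFun (fun x => x) ρAB) : Matrix (A × B × C) (A × B × C) ℂ) *
        extB (matFun (fun x => x⁻¹ * Real.log x) ρB) * extBC (matFun (fun x => x) ρBC)).trace
      + ((extAB (matFun (fun x => x) ρAB) : Matrix (A × B × C) (A × B × C) ℂ) *
        extB (matFun (fun x => x⁻¹) ρB) * extBC (matFun (fun x => x * Real.log x) ρBC)).trace := by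
    rw [e3, e4, e5, interp, ← Finset.sum_sub_distrib, ← Finset.sum_add_distrib]
    refine Finset.sum_congr rfl fun t _ => ?_
    rw [split _ _ _ (n1 _) (n2 _) (n3 _)]
    push_cast
    ring
  have trC : ∀ (F : Matrix (A × B) (A × B) ℂ) (G : Matrix B B ℂ),
      ((extAB F : Matrix (A × B × C) (A × B × C) ℂ) * extB G * extBC ρBC).trace =
      (bptFst F * (G * ρB)).trace := by
    intro F G
    rw [extB_eq_AB, ← extAB_mul, ← trace_ptC, ptC_left, ptC_extBC, dsB, Matrix.mul_assoc,
      ← kron_one_mul, trace_bptFst_mul]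
  have inv1 : matFun (fun x => x⁻¹) ρB * ρB = 1 := by
    have := matFun_mul h2 (fun x => x⁻¹) (fun x => x)
    rw [matFun_id h2] at this
    rw [this, ← matFun_one h2]
    exact matFun_congr h2 fun i => inv_mul_cancel₀ (n2 i).ne'
  have inv2 : ρB * matFun (fun x => x⁻¹) ρB = 1 := by
    have := matFun_mul h2 (fun x => x) (fun x => x⁻¹)
    rw [matFun_id h2] at this
    rw [this, ← matFun_one h2]
    exact matFun_congr h2 fun i => mul_inv_cancel₀ (n2 i).ne'
  have log1 : ρB * (matFun (fun x => x⁻¹ * Real.log x) ρB * ρB) =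
      matFun (fun x => x * Real.log x) ρB := by
    have e1 := matFun_mul h2 (fun x => x⁻¹ * Real.log x) (fun x => x)
    have e2 := matFun_mul h2 (fun x => x) (fun x => x⁻¹ * Real.log x * x)
    rw [matFun_id h2] at e1 e2
    rw [e1, e2]
    refine matFun_congr h2 fun i => ?_
    have := (n2 i).ne'
    field_simp
  have trFst : ∀ F : Matrix (A × B) (A × B) ℂ, (bptFst F).trace = F.trace := by
    intro F
    have := trace_bptFst_mul F 1
    rw [Matrix.one_kronecker_one, Matrix.mul_one, Matrix.mul_one] at this
    exact this.symm
  have trA : ∀ H : Matrix (B × C) (B × C) ℂ,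
      ((extAB ρAB : Matrix (A × B × C) (A × B × C) ℂ) * extB (matFun (fun x => x⁻¹) ρB) *
        extBC H).trace = H.trace := by
    intro H
    rw [extB_eq_BC, Matrix.mul_assoc, ← extBC_mul, ← trace_ptA, ptA_right, ptA_extAB, hρB,
      ← Matrix.mul_assoc, ← kron_mul_one, inv2, Matrix.one_kronecker_one, Matrix.one_mul]
  rw [matFun_id h1, matFun_id h3, trC, trC, trA, inv1, hρB, log1, Matrix.mul_one, trFst] at tot
  have fin : ((qcmi (Θ * Θᴴ) : ℝ) : ℂ) = 0 := by
    rw [qcmi, ptAC_eq, mA, mC, hρB]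
    push_cast
    rw [vnEntropy_eq h0, vnEntropy_eq h1, vnEntropy_eq h2, vnEntropy_eq h3, tot]
    ring
  exact_mod_cast fin
end
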